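/- Let f be a nonnegative multiplicative function for which there exists a constant A1 > 0 with f(p^l) ≤ A1^l for every prime p and integer l ≥ 1, and for every ε > 0 a constant A2(ε) with f(n) ≤ A2(ε) n^ε for all n ≥ 1. Fix 0 < α < 1/2 and 0 < κ < 1/2. Then there exist a constant C > 0 and a threshold x0 (depending only on α, κ, A1 and the function A2) such that for all x ≥ x0, all real y with x^κ ≤ y ≤ x, all integers k with 1 ≤ k < y^{1-α}, and all integers a with gcd(a,k) = 1: ∑_{x ≤ n < x+y, n ≡ a (mod k)} f(n) ≤ C · (y/(φ(k) log x)) · exp(∑_{p ≤ x prime, p ∤ k} f(p)/p). -/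

import Mathlib

open Finset

noncomputable section

/-- A nonnegative multiplicative function: `f ≥ 0`, `f 1 = 1`, and
`f (m n) = f m * f n` whenever `gcd (m, n) = 1`. -/
def MultNonneg (f : ℕ → ℝ) : Prop :=
  (∀ n, 0 ≤ f n) ∧ f 1 = 1 ∧ ∀ m n : ℕ, Nat.Coprime m n → f (m * n) = f m * f n

/-- Shiu's class `M`: `f (p^l) ≤ A1^l` for all primes `p` and `l ≥ 1`, and
`f n ≤ A2 ε * n^ε` for every `ε > 0` and every `n ≥ 1`. -/
def InM (f : ℕ → ℝ) (A1 : ℝ) (A2 : ℝ → ℝ) : Prop :=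
  (∀ p : ℕ, p.Prime → ∀ l : ℕ, 1 ≤ l → f (p ^ l) ≤ A1 ^ l) ∧
  (∀ ε : ℝ, 0 < ε → ∀ n : ℕ, 1 ≤ n → f n ≤ A2 ε * (n : ℝ) ^ ε)

/-! ### An upper-bound sieve in arithmetic progressions -/

lemma sum_divisors_moebius_eq_ite (n : ℕ) :
    ∑ d ∈ n.divisors, (ArithmeticFunction.moebius d : ℝ) = if n = 1 then 1 else 0 := by
  have h := congrArg (fun g : ArithmeticFunction ℤ => g n)
    ArithmeticFunction.coe_zeta_mul_moebius
  simp only [ArithmeticFunction.coe_zeta_mul_apply, ArithmeticFunction.one_apply] at h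
  exact_mod_cast h

lemma sum_moebius_div_filter_dvd {e f : ℕ} (hf : f ≠ 0) :
    ∑ d ∈ f.divisors with e ∣ d, (ArithmeticFunction.moebius (f / d) : ℝ)
      = if e = f then 1 else 0 := by
  by_cases hef : e ∣ f
  · obtain ⟨m, rfl⟩ := hef
    have he : e ≠ 0 := left_ne_zero_of_mul hf
    have hm : m ≠ 0 := right_ne_zero_of_mul hf
    have h1 : ∑ d ∈ (e * m).divisors with e ∣ d, (ArithmeticFunction.moebius (e * m / d) : ℝ)
        = ∑ d ∈ m.divisors, (ArithmeticFunction.moebius d : ℝ) := by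
      rw [← Nat.sum_div_divisors m]
      symm
      refine sum_bij (fun d _ => e * d) ?_ ?_ ?_ ?_
      · intro d hd
        rw [Nat.mem_divisors] at hd
        simp only [mem_filter, Nat.mem_divisors]
        exact ⟨⟨Nat.mul_dvd_mul_left e hd.1, hf⟩, dvd_mul_right e d⟩
      · intro d _ d' _ h
        exact Nat.eq_of_mul_eq_mul_left (Nat.pos_of_ne_zero he) h
      · intro d hd
        simp only [mem_filter, Nat.mem_divisors] at hd
        obtain ⟨⟨h1, _⟩, c, rfl⟩ := hd
        exact ⟨c, Nat.mem_divisors.2 ⟨Nat.dvd_of_mul_dvd_mul_left (Nat.pos_of_ne_zero he) h1, hm⟩,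
          rfl⟩
      · intro d _
        rw [Nat.mul_div_mul_left _ _ (Nat.pos_of_ne_zero he)]
    rw [h1, sum_divisors_moebius_eq_ite]
    have : (e = e * m) ↔ m = 1 := by
      constructor
      · intro h
        exact Nat.eq_of_mul_eq_mul_left (Nat.pos_of_ne_zero he) (by omega)
      · rintro rfl; simp
    simp [this]
  · have hne : e ≠ f := fun h => hef (h ▸ dvd_rfl)
    rw [if_neg hne]
    refine sum_eq_zero fun d hd => ?_
    simp only [mem_filter, Nat.mem_divisors] at hd
    exact absurd (hd.2.trans hd.1.1) hef

/-- Selberg's weights for a divisor-closed set of squarefree moduli. -/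
lemma exists_selberg_weights (S : Finset ℕ) (h1 : 1 ∈ S) (hsq : ∀ d ∈ S, Squarefree d)
    (hdvd : ∀ d ∈ S, ∀ e, e ∣ d → e ∈ S) :
    ∃ w : ℕ → ℝ, w 1 = 1 ∧ (∀ d ∈ S, |w d| ≤ d) ∧
      ∑ d ∈ S, ∑ d' ∈ S, w d * w d' / (Nat.lcm d d' : ℝ)
        = 1 / ∑ e ∈ S, 1 / (Nat.totient e : ℝ) := by
  classical
  have hpos : ∀ d ∈ S, 0 < d := fun d hd => Nat.pos_of_ne_zero (hsq d hd).ne_zero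
  set G : ℝ := ∑ e ∈ S, 1 / (Nat.totient e : ℝ) with hG
  have hGpos : 0 < G := by
    have : 1 / (Nat.totient 1 : ℝ) ≤ G :=
      single_le_sum (f := fun e => 1 / (Nat.totient e : ℝ)) (fun i _ => by positivity) h1
    simp at this; linarith
  set y : ℕ → ℝ := fun e => (ArithmeticFunction.moebius e : ℝ) / (Nat.totient e * G) with hy
  have hmu : ∀ d : ℕ, |(ArithmeticFunction.moebius d : ℝ)| ≤ 1 := fun d => by
    exact_mod_cast ArithmeticFunction.abs_moebius_le_one (n := d)
  set w : ℕ → ℝ := fun d => d * ∑ f ∈ S with d ∣ f, (ArithmeticFunction.moebius (f / d) : ℝ) * y f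
    with hw
  have hmusq : ∀ d ∈ S, (ArithmeticFunction.moebius d : ℝ) * ArithmeticFunction.moebius d = 1 := by
    intro d hd
    have := ArithmeticFunction.moebius_sq_eq_one_of_squarefree (hsq d hd)
    rw [sq] at this
    exact_mod_cast this
  have hinner : ∀ e ∈ S, ∑ d ∈ S with e ∣ d, w d / d = y e := by
    intro e he
    have : ∀ d ∈ S.filter (e ∣ ·), w d / d
        = ∑ f ∈ S, if d ∣ f then (ArithmeticFunction.moebius (f / d) : ℝ) * y f else 0 := by
      intro d hd
      have hd0 : (d : ℝ) ≠ 0 := by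
        exact_mod_cast (hpos d (mem_filter.1 hd).1).ne'
      rw [hw, ← sum_filter]
      field_simp
    rw [sum_congr rfl this, sum_comm]
    have h2 : ∀ f ∈ S, (∑ d ∈ S with e ∣ d,
        if d ∣ f then (ArithmeticFunction.moebius (f / d) : ℝ) * y f else 0)
        = if e = f then y f else 0 := by
      intro f hf
      have h3 : (S.filter (e ∣ ·)).filter (· ∣ f) = f.divisors.filter (e ∣ ·) := by
        ext d
        simp only [mem_filter, Nat.mem_divisors]
        constructor
        · rintro ⟨⟨_, h⟩, h'⟩; exact ⟨⟨h', (hpos f hf).ne'⟩, h⟩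
        · rintro ⟨⟨h', _⟩, h⟩; exact ⟨⟨hdvd f hf d h', h⟩, h'⟩
      rw [← sum_filter, h3, ← sum_mul, sum_moebius_div_filter_dvd (hpos f hf).ne']
      split_ifs <;> simp
    rw [sum_congr rfl h2, sum_ite_eq, if_pos he]
  refine ⟨w, ?_, ?_, ?_⟩
  · have : ∀ f ∈ S, (ArithmeticFunction.moebius f : ℝ) * y f = (1 / (Nat.totient f : ℝ)) / G := by
      intro f hf
      rw [hy]
      simp only
      rw [← mul_div_assoc, hmusq f hf, div_div]
    simp only [hw, Nat.cast_one, one_dvd, filter_true, Nat.div_one, one_mul]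
    rw [sum_congr rfl this, ← sum_div, ← hG, div_self hGpos.ne']
  · intro d hd
    simp only [hw]
    rw [abs_mul, Nat.abs_cast]
    refine mul_le_of_le_one_right (Nat.cast_nonneg d) ?_
    refine (abs_sum_le_sum_abs _ _).trans ?_
    have : ∀ f ∈ S.filter (d ∣ ·), |(ArithmeticFunction.moebius (f / d) : ℝ) * y f|
        ≤ (1 / (Nat.totient f : ℝ)) / G := by
      intro f _
      rw [abs_mul, hy]
      simp only
      rw [abs_div, abs_of_nonneg (by positivity : (0:ℝ) ≤ Nat.totient f * G), div_div]
      have h1 := hmu (f / d)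
      have h2 := hmu f
      have h3 : |(ArithmeticFunction.moebius f : ℝ)| / (Nat.totient f * G)
          ≤ 1 / (Nat.totient f * G) := by gcongr
      calc _ ≤ 1 * (1 / (Nat.totient f * G)) := by gcongr
        _ = _ := one_mul _
    refine (sum_le_sum this).trans ?_
    rw [← sum_div, div_le_one hGpos]
    exact sum_le_sum_of_subset_of_nonneg (filter_subset _ _) fun i _ _ => by positivity
  · have hlcm : ∀ d ∈ S, ∀ d' ∈ S, w d * w d' / (Nat.lcm d d' : ℝ)
        = ∑ e ∈ S, (Nat.totient e : ℝ) * ((if e ∣ d then w d / d else 0) *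
            (if e ∣ d' then w d' / d' else 0)) := by
      intro d hd d' hd'
      have hdp := hpos d hd
      have hdp' := hpos d' hd'
      have hg : ((Nat.gcd d d' : ℕ) : ℝ) = ∑ e ∈ S with (e ∣ d ∧ e ∣ d'), (Nat.totient e : ℝ) := by
        rw [← Nat.sum_totient (Nat.gcd d d')]
        push_cast
        refine sum_congr ?_ fun _ _ => rfl
        ext e
        simp only [mem_filter, Nat.mem_divisors, Nat.dvd_gcd_iff]
        constructor
        · rintro ⟨⟨h, h'⟩, _⟩; exact ⟨hdvd d hd e h, h, h'⟩
        · rintro ⟨_, h⟩; exact ⟨h, (Nat.gcd_pos_of_pos_left _ hdp).ne'⟩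
      have h3 : w d * w d' / (Nat.lcm d d' : ℝ) = Nat.gcd d d' * (w d / d * (w d' / d')) := by
        have : (Nat.gcd d d' : ℝ) * Nat.lcm d d' = d * d' := by exact_mod_cast Nat.gcd_mul_lcm d d'
        have hl : (Nat.lcm d d' : ℝ) ≠ 0 := by
          exact_mod_cast (Nat.lcm_pos hdp hdp').ne'
        have h4 : (d : ℝ) ≠ 0 := by exact_mod_cast hdp.ne'
        have h5 : (d' : ℝ) ≠ 0 := by exact_mod_cast hdp'.ne'
        field_simp
        linear_combination (-(w d * w d')) * this
      rw [h3, hg, sum_mul, sum_filter]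
      refine sum_congr rfl fun e _ => ?_
      by_cases h : e ∣ d <;> by_cases h' : e ∣ d' <;> simp [h, h']
    have hswap : ∑ d ∈ S, ∑ d' ∈ S, w d * w d' / (Nat.lcm d d' : ℝ)
        = ∑ e ∈ S, (Nat.totient e : ℝ) * (y e * y e) := by
      calc _ = ∑ d ∈ S, ∑ d' ∈ S, ∑ e ∈ S, (Nat.totient e : ℝ) *
            ((if e ∣ d then w d / d else 0) * (if e ∣ d' then w d' / d' else 0)) :=
            sum_congr rfl fun d hd => sum_congr rfl fun d' hd' => hlcm d hd d' hd'
        _ = ∑ e ∈ S, ∑ d ∈ S, ∑ d' ∈ S, (Nat.totient e : ℝ) *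
            ((if e ∣ d then w d / d else 0) * (if e ∣ d' then w d' / d' else 0)) := by
            rw [sum_comm]
            rw [sum_congr rfl fun d' _ => sum_comm, sum_comm]
            exact sum_congr rfl fun e _ => sum_comm
        _ = _ := by
            refine sum_congr rfl fun e he => ?_
            rw [← hinner e he, sum_filter, sum_mul_sum, mul_sum]
            simp only [mul_sum]
    rw [hswap]
    have : ∀ e ∈ S, (Nat.totient e : ℝ) * (y e * y e) = (1 / (Nat.totient e : ℝ)) / (G * G) := by
      intro e he
      have h4 : (Nat.totient e : ℝ) ≠ 0 := by
        exact_mod_cast (Nat.totient_pos.2 (hpos e he)).ne'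
      simp only [hy]
      have := hmusq e he
      field_simp
      rw [sq]; exact this
    rw [sum_congr rfl this, ← sum_div, ← hG]
    field_simp

lemma abs_card_filter_modEq_sub_le (N L : ℕ) {r : ℕ} (hr : 0 < r) (v : ℕ) :
    |(#{n ∈ Ico N (N + L) | n ≡ v [MOD r]} : ℝ) - L / r| ≤ 1 := by
  have hr' : (0 : ℝ) < r := by exact_mod_cast hr
  have h := Nat.Ico_filter_modEq_card N (N + L) hr v
  have hmono : ⌈((N : ℚ) - v) / r⌉ ≤ ⌈(((N + L : ℕ) : ℚ) - v) / r⌉ := by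
    apply Int.ceil_mono
    gcongr
    omega
  rw [max_eq_left (by linarith)] at h
  have e1 := Int.le_ceil (((N : ℚ) - v) / r)
  have e2 := Int.ceil_lt_add_one (((N : ℚ) - v) / r)
  have e3 := Int.le_ceil ((((N + L : ℕ) : ℚ) - v) / r)
  have e4 := Int.ceil_lt_add_one ((((N + L : ℕ) : ℚ) - v) / r)
  have e5 : (((N + L : ℕ) : ℚ) - v) / r = ((N : ℚ) - v) / r + (L : ℚ) / r := by
    push_cast; ring
  rw [e5] at e3 e4
  have h' : ((#{n ∈ Ico N (N + L) | n ≡ v [MOD r]} : ℕ) : ℚ)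
      = (⌈(((N + L : ℕ) : ℚ) - v) / r⌉ : ℚ) - (⌈((N : ℚ) - v) / r⌉ : ℚ) := by
    exact_mod_cast h
  rw [e5] at h'
  have key : |((#{n ∈ Ico N (N + L) | n ≡ v [MOD r]} : ℕ) : ℚ) - L / r| ≤ 1 := by
    rw [abs_le, h']
    constructor <;> linarith
  have hcast := (Rat.cast_le (K := ℝ)).2 key
  push_cast at hcast
  exact hcast

/-- The number of multiples of `d` in an arithmetic progression modulo `k`, when `d` is
coprime to `k`. -/
lemma abs_card_filter_modEq_dvd_sub_le (N L c : ℕ) {k d : ℕ} (hk : 0 < k) (hd : 0 < d)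
    (hdk : d.Coprime k) :
    |(#{n ∈ Ico N (N + L) | n ≡ c [MOD k] ∧ d ∣ n} : ℝ) - L / (k * d)| ≤ 1 := by
  obtain ⟨v, hv1, hv2⟩ := Nat.chineseRemainder hdk.symm c 0
  have : ({n ∈ Ico N (N + L) | n ≡ c [MOD k] ∧ d ∣ n} : Finset ℕ)
      = {n ∈ Ico N (N + L) | n ≡ v [MOD (k * d)]} := by
    refine filter_congr fun n _ => ?_
    rw [← Nat.modEq_and_modEq_iff_modEq_mul hdk.symm]
    refine and_congr ⟨fun h => h.trans hv1.symm, fun h => h.trans hv1⟩ ?_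
    rw [← Nat.modEq_zero_iff_dvd]
    exact ⟨fun h => h.trans hv2.symm, fun h => h.trans hv2⟩
  rw [this]
  have := abs_card_filter_modEq_sub_le N L (Nat.mul_pos hk hd) v
  push_cast at this
  exact this

lemma sum_Icc_inv_sq_le_two (D : ℕ) : ∑ m ∈ Icc 1 D, 1 / (m : ℝ) ^ 2 ≤ 2 := by
  rcases Nat.eq_zero_or_pos D with rfl | hD
  · simp
  have h := sum_Ioc_inv_sq_le_sub (α := ℝ) (k := 1) (n := D) one_ne_zero hD
  have h2 : (Icc 1 D : Finset ℕ) = insert 1 (Ioc 1 D) := (Ioc_insert_left hD).symm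
  rw [h2, sum_insert (by simp)]
  simp only [one_div]
  have : (0 : ℝ) ≤ (D : ℝ)⁻¹ := by positivity
  norm_num at h ⊢
  linarith

lemma sum_squarefree_divisors_inv_le {k : ℕ} (hk : 0 < k) :
    ∑ d ∈ k.divisors with Squarefree d, 1 / (d : ℝ) ≤ k / Nat.totient k := by
  have hkr : (0 : ℝ) < k := by exact_mod_cast hk
  have h1 : ∑ d ∈ k.divisors with Squarefree d, 1 / (d : ℝ)
      ≤ ∏ p ∈ k.primeFactors, (1 + 1 / (p : ℝ)) := by
    rw [prod_one_add]
    have hsub : ∀ d ∈ k.divisors.filter (fun d => Squarefree d),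
        d.primeFactors ∈ k.primeFactors.powerset := by
      intro d hd
      simp only [mem_filter, Nat.mem_divisors] at hd
      rw [mem_powerset]
      exact Nat.primeFactors_mono hd.1.1 hk.ne'
    have hinj : Set.InjOn Nat.primeFactors
        (k.divisors.filter (fun d => Squarefree d) : Finset ℕ) := by
      intro d hd e he h
      simp only [coe_filter, Set.mem_ofPred_eq] at hd he
      rw [← Nat.prod_primeFactors_of_squarefree hd.2,
        ← Nat.prod_primeFactors_of_squarefree he.2, h]
    calc ∑ d ∈ k.divisors with Squarefree d, 1 / (d : ℝ)
        = ∑ d ∈ k.divisors with Squarefree d, ∏ p ∈ d.primeFactors, 1 / (p : ℝ) := by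
          refine sum_congr rfl fun d hd => ?_
          rw [prod_div_distrib, prod_const_one, ← Nat.cast_prod,
            Nat.prod_primeFactors_of_squarefree (mem_filter.1 hd).2]
      _ = ∑ t ∈ (k.divisors.filter (fun d => Squarefree d)).image Nat.primeFactors,
            ∏ p ∈ t, 1 / (p : ℝ) :=
          (sum_image (f := fun t : Finset ℕ => ∏ p ∈ t, 1 / (p : ℝ)) hinj).symm
      _ ≤ _ := by
          refine sum_le_sum_of_subset_of_nonneg ?_ fun t _ _ => prod_nonneg fun _ _ => by positivity
          intro t ht
          obtain ⟨d, hd, rfl⟩ := mem_image.1 ht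
          exact hsub d hd
  refine h1.trans ?_
  have h2 : (Nat.totient k : ℝ) = k * ∏ p ∈ k.primeFactors, (1 - (p : ℝ)⁻¹) := by
    have := congrArg (Rat.cast : ℚ → ℝ) (Nat.totient_eq_mul_prod_factors k)
    push_cast at this
    exact this
  have hp : ∀ p ∈ k.primeFactors, (0 : ℝ) < 1 - (p : ℝ)⁻¹ := by
    intro p hp
    have : (1 : ℝ) < p := by exact_mod_cast (Nat.prime_of_mem_primeFactors hp).one_lt
    have := inv_lt_one_of_one_lt₀ this
    linarith
  have hprod : 0 < ∏ p ∈ k.primeFactors, (1 - (p : ℝ)⁻¹) := prod_pos hp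
  rw [h2, le_div_iff₀ (by positivity), mul_left_comm]
  rw [← prod_mul_distrib]
  refine mul_le_of_le_one_right hkr.le (prod_le_one (fun p h => ?_) fun p h => ?_)
  · have := hp p h; positivity
  · rw [one_div]
    nlinarith [sq_nonneg ((p : ℝ)⁻¹)]

/-- Squarefree moduli up to `D` which are coprime to `k`. -/
def sieveModuli (k D : ℕ) : Finset ℕ := (Icc 1 D).filter fun d => Squarefree d ∧ d.Coprime k

lemma log_le_sum_sieveModuli {k : ℕ} (hk : 0 < k) (D : ℕ) :
    Real.log D ≤ 2 * (k / Nat.totient k) * ∑ e ∈ sieveModuli k D, 1 / (Nat.totient e : ℝ) := by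
  have h0 : Real.log D ≤ ∑ n ∈ Icc 1 D, 1 / (n : ℝ) := by
    have := log_le_harmonic_floor (D : ℝ) (Nat.cast_nonneg _)
    rw [Nat.floor_natCast, harmonic_eq_sum_Icc] at this
    push_cast at this
    simpa [one_div] using this
  set Q : Finset ℕ := k.divisors.filter fun d => Squarefree d with hQ
  have h1 : ∑ n ∈ Icc 1 D, 1 / (n : ℝ) ≤
      ∑ t ∈ (Icc 1 D) ×ˢ (Q ×ˢ sieveModuli k D),
        1 / (t.1 : ℝ) ^ 2 * (1 / (t.2.1 : ℝ) * (1 / (t.2.2 : ℝ))) := by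
    have hdec : ∀ n : ℕ, ∃ t : ℕ × ℕ × ℕ, n ∈ Icc 1 D →
        t ∈ (Icc 1 D) ×ˢ (Q ×ˢ sieveModuli k D) ∧ t.1 ^ 2 * (t.2.1 * t.2.2) = n := by
      intro n
      by_cases hn : n ∈ Icc 1 D
      · obtain ⟨a, b, hab, ha⟩ := Nat.sq_mul_squarefree n
        rw [mem_Icc] at hn
        have hnpos : n ≠ 0 := by omega
        have hb : b ≠ 0 := by rintro rfl; simp at hab; omega
        have ha0 : a ≠ 0 := ha.ne_zero
        obtain ⟨c, hc⟩ : a.gcd k ∣ a := Nat.gcd_dvd_left a k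
        have hg : Squarefree (a.gcd k) := ha.squarefree_of_dvd (Nat.gcd_dvd_left a k)
        have hcop : (a.gcd k).Coprime c := by
          rw [hc] at ha; exact Nat.coprime_of_squarefree_mul ha
        have hcs : Squarefree c := ha.squarefree_of_dvd (Dvd.intro_left _ hc.symm)
        have hck : c.Coprime k := by
          have h2 : c.gcd k ∣ (a.gcd k) := Nat.dvd_gcd
            ((Nat.gcd_dvd_left c k).trans (Dvd.intro_left _ hc.symm)) (Nat.gcd_dvd_right c k)
          have h3 : c.gcd k ∣ (a.gcd k).gcd c := Nat.dvd_gcd h2 (Nat.gcd_dvd_left c k)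
          rw [hcop] at h3
          exact Nat.dvd_one.1 h3
        refine ⟨(b, a.gcd k, c), fun _ => ⟨?_, ?_⟩⟩
        · simp only [mem_product, mem_Icc, hQ, mem_filter, Nat.mem_divisors, sieveModuli]
          have hbn : b ∣ n := ⟨b * a, by rw [← hab]; ring⟩
          have hcn : c ∣ n := ((Dvd.intro_left _ hc.symm).trans (Dvd.intro_left _ hab))
          have hbn' := Nat.le_of_dvd (by omega) hbn
          have hcn' := Nat.le_of_dvd (by omega) hcn
          exact ⟨⟨by omega, by omega⟩, ⟨⟨Nat.gcd_dvd_right _ _, hk.ne'⟩, hg⟩,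
            ⟨Nat.pos_of_ne_zero hcs.ne_zero, by omega⟩, hcs, hck⟩
        · simp only
          rw [← hc, hab]
      · exact ⟨(0, 0, 0), fun h => absurd h hn⟩
    choose t ht using hdec
    have hinj : Set.InjOn t (Icc 1 D : Finset ℕ) := by
      intro m hm n hn h
      rw [← (ht m hm).2, ← (ht n hn).2, h]
    calc ∑ n ∈ Icc 1 D, 1 / (n : ℝ)
        = ∑ n ∈ Icc 1 D, 1 / ((t n).1 : ℝ) ^ 2 *
            (1 / ((t n).2.1 : ℝ) * (1 / ((t n).2.2 : ℝ))) := by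
          refine sum_congr rfl fun n hn => ?_
          conv_lhs => rw [← (ht n hn).2]
          push_cast
          rw [one_div_mul_one_div, one_div_mul_one_div]
      _ = ∑ s ∈ (Icc 1 D).image t, 1 / (s.1 : ℝ) ^ 2 *
            (1 / (s.2.1 : ℝ) * (1 / (s.2.2 : ℝ))) :=
          (sum_image (f := fun s : ℕ × ℕ × ℕ => 1 / (s.1 : ℝ) ^ 2 *
            (1 / (s.2.1 : ℝ) * (1 / (s.2.2 : ℝ)))) hinj).symm
      _ ≤ _ := by
          refine sum_le_sum_of_subset_of_nonneg ?_ fun _ _ _ => by positivity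
          intro s hs
          obtain ⟨n, hn, rfl⟩ := mem_image.1 hs
          exact (ht n hn).1
  have h2 : ∑ t ∈ (Icc 1 D) ×ˢ (Q ×ˢ sieveModuli k D),
        1 / (t.1 : ℝ) ^ 2 * (1 / (t.2.1 : ℝ) * (1 / (t.2.2 : ℝ)))
      = (∑ m ∈ Icc 1 D, 1 / (m : ℝ) ^ 2) *
        ((∑ d ∈ Q, 1 / (d : ℝ)) * ∑ e ∈ sieveModuli k D, 1 / (e : ℝ)) := by
    rw [sum_mul_sum, ← sum_product', sum_mul_sum, ← sum_product']
  have h3 : ∑ e ∈ sieveModuli k D, 1 / (e : ℝ)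
      ≤ ∑ e ∈ sieveModuli k D, 1 / (Nat.totient e : ℝ) := by
    refine sum_le_sum fun e he => ?_
    simp only [sieveModuli, mem_filter, mem_Icc] at he
    have : 0 < Nat.totient e := Nat.totient_pos.2 he.1.1
    gcongr
    exact Nat.totient_le e
  calc Real.log D ≤ _ := h0
    _ ≤ _ := h1
    _ = _ := h2
    _ ≤ 2 * ((k / Nat.totient k) * ∑ e ∈ sieveModuli k D, 1 / (Nat.totient e : ℝ)) := by
        gcongr
        · exact sum_Icc_inv_sq_le_two D
        · exact sum_squarefree_divisors_inv_le hk
    _ = _ := by ring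

open Classical in
/-- Upper bound for the number of integers without small prime factors in a segment of an
arithmetic progression. -/
lemma card_sifted_le (N L c : ℕ) {k D : ℕ} (hk : 0 < k) (hD : 2 ≤ D) (hL : D ^ 5 * k ≤ L) :
    (#{n ∈ Ico N (N + L) | n ≡ c [MOD k] ∧ ∀ p : ℕ, p.Prime → p ∣ n → p ∣ k ∨ D < p} : ℝ)
      ≤ 3 * (L / (Nat.totient k * Real.log D)) := by
  set S := sieveModuli k D with hS
  have hmem : ∀ d, d ∈ S ↔ (1 ≤ d ∧ d ≤ D) ∧ Squarefree d ∧ d.Coprime k := by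
    intro d; simp [hS, sieveModuli]
  obtain ⟨w, hw1, hwle, hwsum⟩ := exists_selberg_weights S
    ((hmem 1).2 ⟨⟨le_rfl, by omega⟩, squarefree_one, Nat.coprime_one_left k⟩)
    (fun d hd => ((hmem d).1 hd).2.1)
    (fun d hd e he => by
      have h := (hmem d).1 hd
      have hle := Nat.le_of_dvd h.1.1 he
      have hpos := Nat.pos_of_dvd_of_pos he h.1.1
      exact (hmem e).2 ⟨⟨hpos, hle.trans h.1.2⟩, h.2.1.squarefree_of_dvd he,
        Nat.Coprime.coprime_dvd_left he h.2.2⟩)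
  set G := ∑ e ∈ S, 1 / (Nat.totient e : ℝ) with hG
  have hDr : (2 : ℝ) ≤ D := by exact_mod_cast hD
  have hlogD : 0 < Real.log D := Real.log_pos (by linarith)
  have hkr : (0 : ℝ) < k := by exact_mod_cast hk
  have hphi : (0 : ℝ) < Nat.totient k := by exact_mod_cast Nat.totient_pos.2 hk
  have hGlog := log_le_sum_sieveModuli hk D
  rw [← hS, ← hG] at hGlog
  have hGpos : 0 < G := by
    by_contra! h
    have : 2 * ((k : ℝ) / Nat.totient k) * G ≤ 0 := mul_nonpos_of_nonneg_of_nonpos (by positivity) h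
    linarith
  set A : Finset ℕ := (Ico N (N + L)).filter fun n => n ≡ c [MOD k] with hA
  have hcount : ∀ d ∈ S, ∀ d' ∈ S,
      |(#{n ∈ A | d ∣ n ∧ d' ∣ n} : ℝ) - L / k / (Nat.lcm d d' : ℝ)| ≤ 1 := by
    intro d hd d' hd'
    have h := (hmem d).1 hd
    have h' := (hmem d').1 hd'
    have := abs_card_filter_modEq_dvd_sub_le N L c hk (Nat.lcm_pos h.1.1 h'.1.1)
      (Nat.Coprime.coprime_dvd_left (Nat.lcm_dvd_mul d d') (Nat.Coprime.mul_left h.2.2 h'.2.2))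
    rw [hA, filter_filter, div_div]
    simpa only [Nat.lcm_dvd_iff] using this
  have hsift : (#{n ∈ Ico N (N + L) | n ≡ c [MOD k] ∧
        ∀ p : ℕ, p.Prime → p ∣ n → p ∣ k ∨ D < p} : ℝ)
      ≤ ∑ n ∈ A, (∑ d ∈ S, if d ∣ n then w d else 0) ^ 2 := by
    rw [← filter_filter, ← hA, card_eq_sum_ones, Nat.cast_sum]
    calc _ ≤ ∑ n ∈ A with (∀ p : ℕ, p.Prime → p ∣ n → p ∣ k ∨ D < p),
          (∑ d ∈ S, if d ∣ n then w d else 0) ^ 2 := by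
          refine sum_le_sum fun n hn => ?_
          have hn' := (mem_filter.1 hn).2
          have : ∑ d ∈ S, (if d ∣ n then w d else 0) = 1 := by
            rw [sum_eq_single 1]
            · simp [hw1]
            · intro d hd hd1
              rw [if_neg]
              intro hdn
              obtain ⟨p, hp, hpd⟩ := Nat.exists_prime_and_dvd hd1
              have h := (hmem d).1 hd
              rcases hn' p hp (hpd.trans hdn) with h1 | h1
              · have := Nat.Coprime.coprime_dvd_left hpd h.2.2
                exact hp.one_lt.ne' (Nat.Coprime.eq_one_of_dvd this h1)
              · have := Nat.le_of_dvd h.1.1 hpd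
                omega
            · intro h
              exact absurd ((hmem 1).2 ⟨⟨le_rfl, by omega⟩, squarefree_one,
                Nat.coprime_one_left k⟩) h
          rw [this]; simp
      _ ≤ _ := sum_le_sum_of_subset_of_nonneg (filter_subset _ _) fun _ _ _ => sq_nonneg _
  have hexp : ∑ n ∈ A, (∑ d ∈ S, if d ∣ n then w d else 0) ^ 2
      = ∑ d ∈ S, ∑ d' ∈ S, w d * w d' * (#{n ∈ A | d ∣ n ∧ d' ∣ n} : ℝ) := by
    calc _ = ∑ n ∈ A, ∑ d ∈ S, ∑ d' ∈ S, (if d ∣ n then w d else 0) *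
          (if d' ∣ n then w d' else 0) := by
          refine sum_congr rfl fun n _ => ?_
          rw [sq, sum_mul_sum]
      _ = ∑ d ∈ S, ∑ d' ∈ S, ∑ n ∈ A, (if d ∣ n then w d else 0) *
          (if d' ∣ n then w d' else 0) := by
          rw [sum_comm]
          exact sum_congr rfl fun d _ => sum_comm
      _ = _ := by
          refine sum_congr rfl fun d _ => sum_congr rfl fun d' _ => ?_
          rw [card_filter, Nat.cast_sum, mul_sum]
          refine sum_congr rfl fun n _ => ?_
          by_cases h : d ∣ n <;> by_cases h' : d' ∣ n <;> simp [h, h']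
  have hbound : ∑ d ∈ S, ∑ d' ∈ S, w d * w d' * (#{n ∈ A | d ∣ n ∧ d' ∣ n} : ℝ)
      ≤ L / k * (1 / G) + (D : ℝ) ^ 4 := by
    have hwD : ∀ d ∈ S, |w d| ≤ D := fun d hd => (hwle d hd).trans (by
      exact_mod_cast ((hmem d).1 hd).1.2)
    have hpt : ∀ d ∈ S, ∀ d' ∈ S, w d * w d' * (#{n ∈ A | d ∣ n ∧ d' ∣ n} : ℝ)
        ≤ L / k * (w d * w d' / (Nat.lcm d d' : ℝ)) + (D : ℝ) * D := by
      intro d hd d' hd'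
      have h1 : w d * w d' * ((#{n ∈ A | d ∣ n ∧ d' ∣ n} : ℝ) - L / k / (Nat.lcm d d' : ℝ))
          ≤ (D : ℝ) * D := by
        refine (le_abs_self _).trans ?_
        rw [abs_mul, abs_mul]
        calc _ ≤ (D : ℝ) * D * 1 := by
              gcongr
              · exact hwD d hd
              · exact hwD d' hd'
              · exact hcount d hd d' hd'
          _ = _ := mul_one _
      have h2 : w d * w d' * ((#{n ∈ A | d ∣ n ∧ d' ∣ n} : ℝ) - L / k / (Nat.lcm d d' : ℝ))
        = w d * w d' * (#{n ∈ A | d ∣ n ∧ d' ∣ n} : ℝ)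
          - L / k * (w d * w d' / (Nat.lcm d d' : ℝ)) := by ring
      linarith
    have hScard : (#S : ℝ) ≤ D := by
      have : #S ≤ #(Icc 1 D) := card_le_card (filter_subset _ _)
      rw [Nat.card_Icc] at this
      exact_mod_cast (by omega : #S ≤ D)
    calc _ ≤ ∑ d ∈ S, ∑ d' ∈ S, (L / k * (w d * w d' / (Nat.lcm d d' : ℝ)) + (D : ℝ) * D) :=
          sum_le_sum fun d hd => sum_le_sum fun d' hd' => hpt d hd d' hd'
      _ = L / k * (1 / G) + #S * (#S * ((D : ℝ) * D)) := by
          simp only [sum_add_distrib, sum_const, nsmul_eq_mul, ← mul_sum]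
          rw [hwsum]
      _ ≤ L / k * (1 / G) + D * (D * ((D : ℝ) * D)) := by gcongr
      _ = _ := by ring
  have hLr : (D : ℝ) ^ 5 * k ≤ L := by exact_mod_cast hL
  have hmain : L / k * (1 / G) ≤ 2 * (L / (Nat.totient k * Real.log D)) := by
    rw [div_mul_div_comm, mul_one, mul_div_assoc', div_le_div_iff₀ (by positivity) (by positivity)]
    have : Nat.totient k * Real.log D ≤ 2 * k * G := by
      rw [mul_div_assoc', div_mul_eq_mul_div, le_div_iff₀ hphi] at hGlog
      linarith
    calc (L : ℝ) * (Nat.totient k * Real.log D) ≤ L * (2 * k * G) := by gcongr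
      _ = _ := by ring
  have herr : (D : ℝ) ^ 4 ≤ L / (Nat.totient k * Real.log D) := by
    rw [le_div_iff₀ (by positivity)]
    have h1 : Real.log D ≤ D := (Real.log_le_sub_one_of_pos (by linarith)).trans (by linarith)
    have h2 : (Nat.totient k : ℝ) ≤ k := by exact_mod_cast Nat.totient_le k
    calc (D : ℝ) ^ 4 * (Nat.totient k * Real.log D) ≤ (D : ℝ) ^ 4 * (k * D) := by gcongr
      _ = (D : ℝ) ^ 5 * k := by ring
      _ ≤ L := hLr
  rw [← hexp] at hbound
  linarith

/-! ### Rankin's trick for sums over smooth integers -/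

/-- Upper bound in Mertens' first theorem. -/
lemma sum_prime_log_div_le {N : ℕ} (hN : 0 < N) :
    ∑ p ∈ Icc 1 N with p.Prime, Real.log p / p ≤ Real.log N + Real.log 4 := by
  have hNr : (0 : ℝ) < N := by exact_mod_cast hN
  have hpt : ∀ n ∈ Icc 1 N,
      ∑ p ∈ Icc 1 N with p.Prime, (if p ∣ n then Real.log p else 0) ≤ Real.log N := by
    intro n hn
    rw [mem_Icc] at hn
    have h1 : ({p ∈ {p ∈ Icc 1 N | p.Prime} | p ∣ n} : Finset ℕ) = n.primeFactors := by
      ext p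
      simp only [mem_filter, mem_Icc, Nat.mem_primeFactors]
      constructor
      · rintro ⟨⟨_, hp⟩, hd⟩; exact ⟨hp, hd, by omega⟩
      · rintro ⟨hp, hd, _⟩
        exact ⟨⟨⟨hp.one_lt.le, (Nat.le_of_dvd (by omega) hd).trans hn.2⟩, hp⟩, hd⟩
    rw [← sum_filter, h1, ← Real.log_prod fun p hp => by
      exact_mod_cast (Nat.prime_of_mem_primeFactors hp).ne_zero, ← Nat.cast_prod]
    have h2 := Nat.le_of_dvd (by omega) (Nat.prod_primeFactors_dvd n)
    have h3 : 0 < ∏ p ∈ n.primeFactors, p :=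
      prod_pos fun p hp => (Nat.prime_of_mem_primeFactors hp).pos
    exact Real.log_le_log (by exact_mod_cast h3) (by exact_mod_cast h2.trans hn.2)
  have hsum := sum_le_sum hpt
  rw [sum_comm, sum_const, Nat.card_Icc, nsmul_eq_mul, Nat.add_sub_cancel] at hsum
  have hinner : ∀ p ∈ (Icc 1 N).filter Nat.Prime,
      (N : ℝ) * (Real.log p / p) - Real.log p
        ≤ ∑ n ∈ Icc 1 N, (if p ∣ n then Real.log p else 0) := by
    intro p hp
    have hp0 : 0 < p := (mem_filter.1 hp).2.pos
    rw [← sum_filter, sum_const, nsmul_eq_mul]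
    have hc : #{n ∈ Icc 1 N | p ∣ n} = N / p := Nat.Ioc_filter_dvd_card_eq_div N p
    rw [hc]
    have h4 : (N : ℝ) / p - 1 ≤ ((N / p : ℕ) : ℝ) := by
      rw [← Nat.floor_div_eq_div (K := ℝ)]
      linarith [Nat.lt_floor_add_one ((N : ℝ) / p)]
    have hlog : 0 ≤ Real.log p := Real.log_natCast_nonneg p
    calc _ = ((N : ℝ) / p - 1) * Real.log p := by ring
      _ ≤ _ := by gcongr
  have htheta : ∑ p ∈ Icc 1 N with p.Prime, Real.log p ≤ Real.log 4 * N := by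
    have := Chebyshev.theta_le_log4_mul_x (x := (N : ℝ)) hNr.le
    rw [Chebyshev.theta, Nat.floor_natCast] at this
    exact this
  have h5 := (sum_le_sum hinner).trans hsum
  rw [sum_sub_distrib, ← mul_sum] at h5
  have h6 : (N : ℝ) * ∑ p ∈ Icc 1 N with p.Prime, Real.log p / p
      ≤ N * (Real.log N + Real.log 4) := by linarith
  exact le_of_mul_le_mul_left h6 hNr

lemma two_rpow_neg_three_quarters_le : (2 : ℝ) ^ (-(3 / 4) : ℝ) ≤ 3 / 4 := by
  have h1 : (2 : ℝ) ^ (-(3 / 4) : ℝ) ≤ 2 ^ (-(1 / 2) : ℝ) :=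
    Real.rpow_le_rpow_of_exponent_le (by norm_num) (by norm_num)
  have h2 : (2 : ℝ) ^ (-(1 / 2) : ℝ) ≤ 3 / 4 := by
    rw [Real.rpow_neg (by norm_num), ← Real.sqrt_eq_rpow]
    have : (4 / 3 : ℝ) ≤ √2 := Real.le_sqrt_of_sq_le (by norm_num)
    calc (√2)⁻¹ ≤ (4 / 3 : ℝ)⁻¹ := by gcongr
      _ = 3 / 4 := by norm_num
  exact h1.trans h2

/-- The Euler factor at `p` of a function in the class `InM`, twisted by `n ^ (δ - 1)`. -/
lemma summable_and_tsum_prime_pow_le {f : ℕ → ℝ} {A1 : ℝ} {A2 : ℝ → ℝ} (hf : MultNonneg f)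
    (hM : InM f A1 A2) {δ : ℝ} (hδ' : δ ≤ 1 / 8) {p : ℕ} (hp : p.Prime) :
    Summable (fun n : ℕ => f (p ^ n) * ((p ^ n : ℕ) : ℝ) ^ (δ - 1)) ∧
      ∑' n : ℕ, f (p ^ n) * ((p ^ n : ℕ) : ℝ) ^ (δ - 1)
        ≤ 1 + f p / p * (p : ℝ) ^ δ + 4 * |A2 (1 / 8)| * (1 / (p : ℝ) ^ (3 / 2 : ℝ)) := by
  have hp1 : (1 : ℝ) ≤ p := by exact_mod_cast hp.one_lt.le
  have hp2 : (2 : ℝ) ≤ p := by exact_mod_cast hp.two_le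
  have hp0 : (0 : ℝ) < p := by linarith
  set t : ℝ := (p : ℝ) ^ (-(3 / 4) : ℝ) with ht
  have ht0 : 0 < t := Real.rpow_pos_of_pos hp0 _
  have ht1 : t ≤ 3 / 4 := by
    refine le_trans ?_ two_rpow_neg_three_quarters_le
    exact Real.rpow_le_rpow_of_nonpos (by norm_num) hp2 (by norm_num)
  set g : ℕ → ℝ := fun n => f (p ^ n) * ((p ^ n : ℕ) : ℝ) ^ (δ - 1) with hg
  have hg0 : ∀ n, 0 ≤ g n := fun n => mul_nonneg (hf.1 _) (by positivity)
  have hgle : ∀ n, g n ≤ |A2 (1 / 8)| * t ^ n := by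
    intro n
    have hpn : (1 : ℝ) ≤ ((p ^ n : ℕ) : ℝ) := by exact_mod_cast Nat.one_le_pow _ _ hp.pos
    have h1 := hM.2 (1 / 8) (by norm_num) (p ^ n) (Nat.one_le_pow _ _ hp.pos)
    have h2 : A2 (1 / 8) ≤ |A2 (1 / 8)| := le_abs_self _
    have h3 : ((p ^ n : ℕ) : ℝ) ^ (δ - 1) ≤ ((p ^ n : ℕ) : ℝ) ^ (-(7 / 8) : ℝ) :=
      Real.rpow_le_rpow_of_exponent_le hpn (by linarith)
    have h4 : ((p ^ n : ℕ) : ℝ) ^ (1 / 8 : ℝ) * ((p ^ n : ℕ) : ℝ) ^ (-(7 / 8) : ℝ) = t ^ n := by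
      rw [← Real.rpow_add (by linarith), ht, ← Real.rpow_mul_natCast hp0.le, Nat.cast_pow,
        ← Real.rpow_natCast_mul hp0.le]
      congr 1; ring
    calc g n ≤ (|A2 (1 / 8)| * ((p ^ n : ℕ) : ℝ) ^ (1 / 8 : ℝ)) *
          ((p ^ n : ℕ) : ℝ) ^ (-(7 / 8) : ℝ) := by
          refine mul_le_mul (h1.trans ?_) h3 (by positivity) (by positivity)
          gcongr
      _ = _ := by rw [mul_assoc, h4]
  have hgeom : Summable fun n : ℕ => |A2 (1 / 8)| * t ^ n :=
    (summable_geometric_of_lt_one ht0.le (by linarith)).mul_left _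
  have hs : Summable g := Summable.of_nonneg_of_le hg0 hgle hgeom
  refine ⟨hs, ?_⟩
  rw [← hs.sum_add_tsum_nat_add 2, sum_range_succ, sum_range_one]
  have e0 : g 0 = 1 := by simp [hg, hf.2.1]
  have e1 : g 1 = f p / p * (p : ℝ) ^ δ := by
    simp only [hg, pow_one]
    rw [Real.rpow_sub_one hp0.ne']
    ring
  have e2 : ∑' n, g (n + 2) ≤ 4 * |A2 (1 / 8)| * (1 / (p : ℝ) ^ (3 / 2 : ℝ)) := by
    have hg2 : Summable fun n : ℕ => |A2 (1 / 8)| * t ^ (n + 2) :=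
      (summable_nat_add_iff 2).2 hgeom
    have hs2 : Summable fun n : ℕ => g (n + 2) := (summable_nat_add_iff 2).2 hs
    have h5 : ∑' n, g (n + 2) ≤ ∑' n : ℕ, |A2 (1 / 8)| * t ^ (n + 2) :=
      hs2.tsum_le_tsum (fun n => hgle (n + 2)) hg2
    have h6 : ∑' n : ℕ, |A2 (1 / 8)| * t ^ (n + 2) = |A2 (1 / 8)| * t ^ 2 * (1 - t)⁻¹ := by
      simp_rw [pow_add, ← mul_assoc]
      rw [tsum_mul_right, tsum_mul_left, tsum_geometric_of_lt_one ht0.le (by linarith)]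
      ring
    have h7 : (1 - t)⁻¹ ≤ 4 := by
      rw [inv_le_comm₀ (by linarith) (by norm_num)]
      linarith
    have h8 : t ^ 2 = 1 / (p : ℝ) ^ (3 / 2 : ℝ) := by
      rw [ht, ← Real.rpow_mul_natCast hp0.le, one_div, ← Real.rpow_neg hp0.le]
      norm_num
    calc _ ≤ |A2 (1 / 8)| * t ^ 2 * (1 - t)⁻¹ := h5.trans h6.le
      _ ≤ |A2 (1 / 8)| * t ^ 2 * 4 := by gcongr
      _ = _ := by rw [h8]; ring
  rw [e0, e1]
  linarith

lemma exp_le_one_add_mul_exp {x c : ℝ} (hx : 0 ≤ x) (hxc : x ≤ c) :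
    Real.exp x ≤ 1 + x * Real.exp c := by
  have h1 := Real.add_one_le_exp (-x)
  have h2 : Real.exp x * Real.exp (-x) = 1 := by rw [← Real.exp_add]; simp
  have h3 : Real.exp x ≤ Real.exp c := Real.exp_le_exp.2 hxc
  have h4 := Real.exp_pos x
  nlinarith

/-- Sums of `f n * n ^ (δ - 1)` over smooth integers, with `δ` of the order of the reciprocal of
the logarithm of the smoothness bound. -/
lemma sum_smooth_le {f : ℕ → ℝ} {A1 : ℝ} {A2 : ℝ → ℝ} (hf : MultNonneg f) (hM : InM f A1 A2)
    (hA1 : 0 < A1) {K W : ℝ} (hK : 0 < K) (hKW : 8 * K ≤ W) (hW : 1 ≤ W) (k : ℕ) (S : Finset ℕ)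
    (hS : ∀ b ∈ S, 0 < b ∧ b.Coprime k ∧ ∀ p : ℕ, p.Prime → p ∣ b → Real.log p ≤ W) :
    ∑ b ∈ S, f b * (b : ℝ) ^ (K / W - 1) ≤
      Real.exp (3 * A1 * K * Real.exp K
        + 4 * |A2 (1 / 8)| * ∑' n : ℕ, 1 / (n : ℝ) ^ (3 / 2 : ℝ)) *
      Real.exp (∑ p ∈ Icc 1 ⌊Real.exp W⌋₊ with (p.Prime ∧ ¬ p ∣ k), f p / p) := by
  have hW0 : 0 < W := by linarith
  set δ := K / W with hδdef
  have hδ : 0 < δ := by positivity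
  have hδ' : δ ≤ 1 / 8 := by rw [hδdef, div_le_iff₀ hW0]; linarith
  set T : Finset ℕ := (Icc 1 ⌊Real.exp W⌋₊).filter (fun p => p.Prime ∧ ¬ p ∣ k) with hT
  set g : ℕ → ℝ := fun n => f n * (n : ℝ) ^ (δ - 1) with hg
  have hg0 : ∀ n, 0 ≤ g n := fun n => mul_nonneg (hf.1 _) (by positivity)
  have hTp : ∀ p ∈ T, p.Prime := fun p hp => (mem_filter.1 hp).2.1
  obtain ⟨hsum, hhas⟩ := EulerProduct.summable_and_hasSum_factoredNumbers_prod_filter_prime_tsum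
    (f := g) (by simp [hg, hf.2.1])
    (by
      intro m n hmn
      simp only [hg]
      rw [hf.2.2 m n hmn, Nat.cast_mul, Real.mul_rpow (Nat.cast_nonneg _) (Nat.cast_nonneg _)]
      ring)
    (by
      intro p hp
      refine (summable_and_tsum_prime_pow_le hf hM hδ' hp).1.congr fun n => ?_
      exact (Real.norm_of_nonneg (hg0 _)).symm) T
  rw [filter_true_of_mem hTp] at hhas
  have hSmem : ∀ b ∈ S, b ∈ Nat.factoredNumbers T := by
    intro b hb
    obtain ⟨hb0, hbk, hbp⟩ := hS b hb
    rw [Nat.mem_factoredNumbers']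
    intro p hp hpb
    rw [hT, mem_filter, mem_Icc]
    refine ⟨⟨hp.one_lt.le, Nat.le_floor ?_⟩, hp, fun hpk => ?_⟩
    · rw [← Real.log_le_iff_le_exp (by exact_mod_cast hp.pos)]
      exact hbp p hp hpb
    · exact Nat.Prime.not_coprime_iff_dvd.2 ⟨p, hp, hpb, hpk⟩ hbk
  have h1 : ∑ b ∈ S, g b ≤ ∏ p ∈ T, ∑' n : ℕ, g (p ^ n) := by
    have h2 : ∑ b ∈ S, g b = ∑ b ∈ S.attach.image
        (fun b => (⟨b.1, hSmem b.1 b.2⟩ : Nat.factoredNumbers T)), g b := by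
      rw [sum_image, sum_attach S (fun b => g b)]
      intro a _ b _ h
      exact Subtype.ext (congrArg (fun x : Nat.factoredNumbers T => (x : ℕ)) h)
    rw [h2]
    exact sum_le_hasSum _ (fun b _ => hg0 b) hhas
  have h3 : ∀ p ∈ T, ∑' n : ℕ, g (p ^ n) ≤ Real.exp (f p / p +
      A1 * δ * Real.exp K * (Real.log p / p)
        + 4 * |A2 (1 / 8)| * (1 / (p : ℝ) ^ (3 / 2 : ℝ))) := by
    intro p hpT
    have hp := hTp p hpT
    have hp0 : (0 : ℝ) < p := by exact_mod_cast hp.pos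
    refine (summable_and_tsum_prime_pow_le hf hM hδ' hp).2.trans ?_
    have hlogp : Real.log p ≤ W := by
      rw [Real.log_le_iff_le_exp hp0]
      exact (Nat.le_floor_iff (by positivity)).1 (mem_Icc.1 (mem_filter.1 hpT).1).2
    have hlog0 : 0 ≤ Real.log p := Real.log_natCast_nonneg p
    have h4 : (p : ℝ) ^ δ ≤ 1 + δ * Real.log p * Real.exp K := by
      rw [Real.rpow_def_of_pos hp0, mul_comm (Real.log p)]
      refine exp_le_one_add_mul_exp (by positivity) ?_
      calc δ * Real.log p ≤ δ * W := by gcongr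
        _ = K := by rw [hδdef]; field_simp
    have h5 : f p ≤ A1 := by simpa using hM.1 p hp 1 le_rfl
    have h6 : f p / p * (p : ℝ) ^ δ
        ≤ f p / p + A1 * δ * Real.exp K * (Real.log p / p) := by
      have := hf.1 p
      calc f p / p * (p : ℝ) ^ δ ≤ f p / p * (1 + δ * Real.log p * Real.exp K) := by gcongr
        _ = f p / p + f p * (δ * Real.exp K * (Real.log p / p)) := by ring
        _ ≤ f p / p + A1 * (δ * Real.exp K * (Real.log p / p)) := by gcongr
        _ = _ := by ring
    refine le_trans ?_ (Real.add_one_le_exp _)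
    linarith
  have h7 : ∏ p ∈ T, ∑' n : ℕ, g (p ^ n) ≤ Real.exp (∑ p ∈ T, (f p / p +
      A1 * δ * Real.exp K * (Real.log p / p)
        + 4 * |A2 (1 / 8)| * (1 / (p : ℝ) ^ (3 / 2 : ℝ)))) := by
    rw [Real.exp_sum]
    exact prod_le_prod (fun p _ => tsum_nonneg fun n => hg0 _) h3
  refine (h1.trans h7).trans ?_
  rw [← Real.exp_add, Real.exp_le_exp, sum_add_distrib, sum_add_distrib, ← mul_sum, ← mul_sum]
  have h8 : ∑ p ∈ T, Real.log p / p ≤ 3 * W := by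
    have hfl : 0 < ⌊Real.exp W⌋₊ := Nat.floor_pos.2 (Real.one_le_exp hW0.le)
    have h9 := sum_prime_log_div_le hfl
    have h10 : Real.log ⌊Real.exp W⌋₊ ≤ W := by
      rw [Real.log_le_iff_le_exp (by exact_mod_cast hfl)]
      exact Nat.floor_le (Real.exp_pos _).le
    have h11 : Real.log 4 ≤ 2 := by
      have : Real.log 4 = 2 * Real.log 2 := by
        rw [show (4 : ℝ) = 2 ^ 2 by norm_num, Real.log_pow]; norm_num
      linarith [Real.log_two_lt_d9]
    have h12 : ∑ p ∈ T, Real.log p / p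
        ≤ ∑ p ∈ Icc 1 ⌊Real.exp W⌋₊ with p.Prime, Real.log p / p := by
      refine sum_le_sum_of_subset_of_nonneg ?_ fun p _ _ =>
        div_nonneg (Real.log_natCast_nonneg p) (Nat.cast_nonneg p)
      intro p hp
      rw [hT, mem_filter] at hp
      exact mem_filter.2 ⟨hp.1, hp.2.1⟩
    linarith
  have h13 : A1 * δ * Real.exp K * ∑ p ∈ T, Real.log p / p ≤ 3 * A1 * K * Real.exp K := by
    calc A1 * δ * Real.exp K * ∑ p ∈ T, Real.log p / p ≤ A1 * δ * Real.exp K * (3 * W) := by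
          gcongr
      _ = _ := by rw [hδdef]; field_simp
  have h14 : ∑ p ∈ T, 1 / (p : ℝ) ^ (3 / 2 : ℝ) ≤ ∑' n : ℕ, 1 / (n : ℝ) ^ (3 / 2 : ℝ) :=
    (Real.summable_one_div_nat_rpow.2 (by norm_num)).sum_le_tsum T fun n _ => by positivity
  have h15 := mul_le_mul_of_nonneg_left h14 (by positivity : 0 ≤ 4 * |A2 (1 / 8)|)
  linarith

/-! ### Splitting an integer at a threshold -/

lemma exists_threshold_factorization {n : ℕ} {z : ℝ} (hz : 1 ≤ z) (hzn : z < n) :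
    ∃ b d q : ℕ, n = b * d ∧ b.Coprime d ∧ (b : ℝ) ≤ z ∧ q.Prime ∧
      (∀ p : ℕ, p.Prime → p ∣ b → p < q) ∧ (∀ p : ℕ, p.Prime → p ∣ d → q ≤ p) ∧
      z < b * (q : ℝ) ^ n.factorization q := by
  classical
  have hn : n ≠ 0 := by
    rintro rfl
    rw [Nat.cast_zero] at hzn
    linarith
  set F : ℕ → ℕ := fun t => ∏ p ∈ n.primeFactors with p ≤ t, p ^ n.factorization p with hF
  have hFn : F n = n := by
    rw [hF]
    simp only
    rw [filter_true_of_mem fun p hp => Nat.le_of_mem_primeFactors hp]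
    exact Nat.prod_factorization_pow_eq_self hn
  have hex : ∃ t, z < (F t : ℝ) := ⟨n, by rw [hFn]; exact hzn⟩
  set q := Nat.find hex with hq
  have hqz : z < (F q : ℝ) := Nat.find_spec hex
  have hF0 : F 0 = 1 := by
    rw [hF]
    refine prod_eq_one fun p hp => ?_
    rw [mem_filter] at hp
    have := (Nat.prime_of_mem_primeFactors hp.1).pos
    omega
  have hq0 : q ≠ 0 := by
    intro h
    rw [h, hF0, Nat.cast_one] at hqz
    linarith
  obtain ⟨s, hs⟩ : ∃ s, q = s + 1 := Nat.exists_eq_succ_of_ne_zero hq0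
  have hsz : (F s : ℝ) ≤ z := not_lt.1 (Nat.find_min hex (by omega))
  have hqmem : q ∈ n.primeFactors := by
    by_contra hmem
    have : F q = F s := by
      rw [hF]
      refine prod_congr (filter_congr fun p hp => ?_) fun _ _ => rfl
      have : p ≠ q := fun h => hmem (h ▸ hp)
      omega
    rw [this] at hqz
    linarith
  have hqp := Nat.prime_of_mem_primeFactors hqmem
  have hFq : F q = F s * q ^ n.factorization q := by
    have : n.primeFactors.filter (· ≤ q) = insert q (n.primeFactors.filter (· ≤ s)) := by
      ext p
      simp only [mem_filter, mem_insert]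
      constructor
      · rintro ⟨h1, h2⟩
        rcases Nat.lt_or_ge s p with h | h
        · exact Or.inl (by omega)
        · exact Or.inr ⟨h1, h⟩
      · rintro (rfl | ⟨h1, h2⟩)
        · exact ⟨hqmem, le_rfl⟩
        · exact ⟨h1, by omega⟩
    rw [hF]
    simp only
    rw [this, prod_insert (by simp only [mem_filter]; omega), mul_comm]
  refine ⟨F s, ∏ p ∈ n.primeFactors with ¬ p ≤ s, p ^ n.factorization p, q, ?_, ?_, hsz, hqp,
    ?_, ?_, ?_⟩
  · rw [hF]
    simp only
    rw [prod_filter_mul_prod_filter_not]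
    exact (Nat.prod_factorization_pow_eq_self hn).symm
  · refine Nat.Coprime.prod_left fun p hp => Nat.Coprime.prod_right fun p' hp' => ?_
    rw [mem_filter] at hp hp'
    refine Nat.Coprime.pow _ _ ((Nat.coprime_primes (Nat.prime_of_mem_primeFactors hp.1)
      (Nat.prime_of_mem_primeFactors hp'.1)).2 ?_)
    rintro rfl
    exact hp'.2 hp.2
  · intro p hp hpd
    obtain ⟨p', hp', h⟩ := (hp.prime.dvd_finsetProd_iff _).1 hpd
    rw [mem_filter] at hp'
    have := (Nat.prime_dvd_prime_iff_eq hp (Nat.prime_of_mem_primeFactors hp'.1)).1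
      (hp.dvd_of_dvd_pow h)
    omega
  · intro p hp hpd
    obtain ⟨p', hp', h⟩ := (hp.prime.dvd_finsetProd_iff _).1 hpd
    rw [mem_filter] at hp'
    have := (Nat.prime_dvd_prime_iff_eq hp (Nat.prime_of_mem_primeFactors hp'.1)).1
      (hp.dvd_of_dvd_pow h)
    omega
  · rw [hFq] at hqz
    exact_mod_cast hqz

lemma exists_sq_dvd_of_prime_pow_dvd {n p v : ℕ} {M z : ℝ} (hp : p.Prime) (hv : p ^ v ∣ n)
    (hM : 1 ≤ M) (hMz : M ^ 2 ≤ z) (hMv : M ^ 4 < (p : ℝ) ^ v)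
    (h : (p : ℝ) ≤ M ∨ (2 ≤ v ∧ (p : ℝ) ≤ z)) :
    ∃ m : ℕ, M < m ∧ (m : ℝ) ≤ z ∧ m ^ 2 ∣ n := by
  by_cases hpM : (p : ℝ) ≤ M
  · have hp1 : (1 : ℝ) < p := by exact_mod_cast hp.one_lt
    have hex : ∃ j, M < (p : ℝ) ^ j := pow_unbounded_of_one_lt M hp1
    classical
    have hspec := Nat.find_spec hex
    have hmin := fun {i : ℕ} => Nat.find_min hex (m := i)
    set j := Nat.find hex
    have hj0 : j ≠ 0 := by
      intro h
      rw [h, pow_zero] at hspec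
      linarith
    obtain ⟨i, hi⟩ : ∃ i, j = i + 1 := Nat.exists_eq_succ_of_ne_zero hj0
    have hile : (p : ℝ) ^ i ≤ M := not_lt.1 (hmin (by omega))
    have hjle : (p : ℝ) ^ j ≤ M ^ 2 := by
      rw [hi, pow_succ, sq]
      gcongr
    have h2j : 2 * j ≤ v := by
      have h1 : (p : ℝ) ^ (2 * j) < (p : ℝ) ^ v := by
        calc (p : ℝ) ^ (2 * j) = ((p : ℝ) ^ j) ^ 2 := by rw [← pow_mul, mul_comm]
          _ ≤ (M ^ 2) ^ 2 := by gcongr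
          _ = M ^ 4 := by ring
          _ < _ := hMv
      exact ((pow_lt_pow_iff_right₀ hp1).1 h1).le
    refine ⟨p ^ j, by exact_mod_cast hspec, by push_cast; linarith, ?_⟩
    rw [← pow_mul, mul_comm]
    exact (pow_dvd_pow p h2j).trans hv
  · obtain ⟨h2, hpz⟩ := h.resolve_left hpM
    exact ⟨p, not_le.1 hpM, hpz, (pow_dvd_pow p h2).trans hv⟩

/-- An integer without a large square divisor splits as `b * d` with `b` smooth and `d` rough. -/
lemma exists_smooth_mul_rough {n W₀ : ℕ} {K Z : ℝ} (hK : 0 < K) (hZ : 8 * K ≤ Z)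
    (hW₀ : Real.exp (8 * K) ≤ W₀) (hWZ : (W₀ : ℝ) ≤ Real.exp (Z / (8 * W₀)))
    (hZn : Real.exp Z < n)
    (hn : ∀ m : ℕ, Real.exp (Z / (8 * W₀)) < m → (m : ℝ) ≤ Real.exp Z → ¬ m ^ 2 ∣ n) :
    ∃ r b d : ℕ, 1 ≤ r ∧ 8 * K * r ≤ Z ∧ n = b * d ∧ b.Coprime d ∧ Real.log b ≤ Z ∧
      (∀ p : ℕ, p.Prime → p ∣ b → Real.log p ≤ Z / r) ∧ (2 ≤ r → Z / 2 < Real.log b) ∧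
      (∀ p : ℕ, p.Prime → p ∣ d → Z / (r + 1) < Real.log p) := by
  have hZ0 : 0 < Z := by linarith
  have hW1 : (1 : ℝ) ≤ W₀ := (Real.one_le_exp (by positivity)).trans hW₀
  have hW0 : (0 : ℝ) < W₀ := by linarith
  set M := Real.exp (Z / (8 * W₀)) with hM
  have hM1 : 1 ≤ M := hW1.trans hWZ
  have hM4 : M ^ 4 = Real.exp (Z / (2 * W₀)) := by
    rw [hM, ← Real.exp_nat_mul]
    congr 1
    push_cast
    field_simp
    norm_num
  have hM4' : M ^ 4 ≤ Real.exp (Z / 2) := by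
    rw [hM4, Real.exp_le_exp]
    gcongr
    linarith
  have hhalf : Real.exp (Z / 2) ≤ Real.exp Z := Real.exp_le_exp.2 (by linarith)
  have hM2 : M ^ 2 ≤ Real.exp Z := by
    have : M ^ 2 ≤ M ^ 4 := pow_le_pow_right₀ hM1 (by norm_num)
    linarith
  obtain ⟨b, d, q, hbd, hcop, hbz, hq, hbq, hdq, hbqz⟩ :=
    exists_threshold_factorization (Real.one_le_exp hZ0.le) hZn
  have hn0 : n ≠ 0 := by
    rintro rfl
    have := Real.exp_pos Z
    rw [Nat.cast_zero] at hZn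
    linarith
  have hb0 : b ≠ 0 := by rintro rfl; simp at hbd; exact hn0 hbd
  have hb0' : (0 : ℝ) < b := by exact_mod_cast Nat.pos_of_ne_zero hb0
  have hq0 : (0 : ℝ) < q := by exact_mod_cast hq.pos
  have hlogb : Real.log b ≤ Z := (Real.log_le_iff_le_exp hb0').2 hbz
  have hQ : 0 < Real.log q := Real.log_pos (by exact_mod_cast hq.one_lt)
  have hloghelper : ∀ p : ℕ, p.Prime → q ≤ p → Real.log q ≤ Real.log p := fun p _ h =>
    Real.log_le_log hq0 (by exact_mod_cast h)
  by_cases hqZ : Z / 2 < Real.log q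
  · refine ⟨1, b, d, le_rfl, by simpa using hZ, hbd, hcop, hlogb, ?_, by omega, ?_⟩
    · intro p hp hpb
      have hpb' : (p : ℝ) ≤ b := by exact_mod_cast Nat.le_of_dvd (Nat.pos_of_ne_zero hb0) hpb
      have := Real.log_le_log (by exact_mod_cast hp.pos) hpb'
      simpa using this.trans hlogb
    · intro p hp hpd
      have := hloghelper p hp (hdq p hp hpd)
      norm_num
      linarith
  · have hqZ' : Real.log q ≤ Z / 2 := not_lt.1 hqZ
    have hqhalf : (q : ℝ) ≤ Real.exp (Z / 2) := (Real.log_le_iff_le_exp hq0).1 hqZ'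
    have hbhalf : Real.exp (Z / 2) < b := by
      by_contra! hb
      have h1 : Real.exp (Z / 2) < (q : ℝ) ^ n.factorization q := by
        have h2 : Real.exp Z = Real.exp (Z / 2) * Real.exp (Z / 2) := by
          rw [← Real.exp_add]; congr 1; ring
        by_contra! h3
        have : (b : ℝ) * (q : ℝ) ^ n.factorization q ≤ Real.exp (Z / 2) * Real.exp (Z / 2) := by
          gcongr
        linarith
      have h2 : 2 ≤ n.factorization q := by
        by_contra! h3
        have : (q : ℝ) ^ n.factorization q ≤ (q : ℝ) ^ 1 :=
          pow_le_pow_right₀ (by exact_mod_cast hq.one_lt.le) (by omega)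
        rw [pow_one] at this
        linarith
      obtain ⟨m, hm1, hm2, hm3⟩ := exists_sq_dvd_of_prime_pow_dvd hq (Nat.ordProj_dvd n q) hM1 hM2
        (hM4'.trans_lt h1) (Or.inr ⟨h2, hqhalf.trans hhalf⟩)
      exact hn m hm1 hm2 hm3
    have hqW : (W₀ : ℝ) < q := by
      by_contra! hqW
      have hqW' : q ≤ W₀ := by exact_mod_cast hqW
      have hsmall : ∀ p ∈ b.primeFactors, (p : ℝ) ^ b.factorization p ≤ M ^ 4 := by
        intro p hp
        by_contra! h
        have hpp := Nat.prime_of_mem_primeFactors hp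
        have hpq := hbq p hpp (Nat.dvd_of_mem_primeFactors hp)
        have hpW : (p : ℝ) ≤ W₀ := by exact_mod_cast (hpq.le.trans hqW')
        obtain ⟨m, hm1, hm2, hm3⟩ := exists_sq_dvd_of_prime_pow_dvd hpp
          ((Nat.ordProj_dvd b p).trans (Dvd.intro d hbd.symm)) hM1 hM2 h (Or.inl (hpW.trans hWZ))
        exact hn m hm1 hm2 hm3
      have hcard : #b.primeFactors ≤ W₀ := by
        have : b.primeFactors ⊆ Ico 1 (W₀ + 1) := by
          intro p hp
          have hpp := Nat.prime_of_mem_primeFactors hp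
          have hpq := hbq p hpp (Nat.dvd_of_mem_primeFactors hp)
          exact mem_Ico.2 ⟨hpp.one_lt.le, by omega⟩
        have := card_le_card this
        simpa using this
      have hb1 : (b : ℝ) = ∏ p ∈ b.primeFactors, (p : ℝ) ^ b.factorization p := by
        conv_lhs => rw [← Nat.prod_factorization_pow_eq_self hb0]
        rw [Finsupp.prod, Nat.support_factorization]
        push_cast
        rfl
      have hb2 : (b : ℝ) ≤ Real.exp (Z / 2) := by
        calc (b : ℝ) ≤ ∏ p ∈ b.primeFactors, M ^ 4 := by
              rw [hb1]
              exact prod_le_prod (fun _ _ => by positivity) hsmall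
          _ = (M ^ 4) ^ #b.primeFactors := prod_const _
          _ ≤ (M ^ 4) ^ W₀ := pow_le_pow_right₀ (one_le_pow₀ hM1) hcard
          _ = Real.exp (Z / 2) := by
              rw [hM4, ← Real.exp_nat_mul]
              congr 1
              field_simp
      linarith
    have hKq : 8 * K < Real.log q := (Real.lt_log_iff_exp_lt hq0).2 (hW₀.trans_lt hqW)
    set r := ⌊Z / Real.log q⌋₊ with hr
    have hr1 : 2 ≤ r := by
      refine Nat.le_floor ?_
      rw [Nat.cast_ofNat, le_div_iff₀ hQ]
      linarith
    have hr0 : (0 : ℝ) < r := by exact_mod_cast (by omega : 0 < r)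
    have hrle : (r : ℝ) * Real.log q ≤ Z := by
      rw [← le_div_iff₀ hQ]
      exact Nat.floor_le (by positivity)
    have hrlt : Z / (r + 1) < Real.log q := by
      rw [div_lt_iff₀ (by positivity), mul_comm, ← div_lt_iff₀ hQ]
      exact Nat.lt_floor_add_one _
    refine ⟨r, b, d, by omega, ?_, hbd, hcop, hlogb, ?_, fun _ => ?_, ?_⟩
    · calc 8 * K * r ≤ Real.log q * r := by gcongr
        _ ≤ Z := by linarith
    · intro p hp hpb
      have h1 := Real.log_le_log (by exact_mod_cast hp.pos)
        (by exact_mod_cast (hbq p hp hpb).le : (p : ℝ) ≤ q)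
      refine h1.trans ?_
      rw [le_div_iff₀ hr0]
      linarith
    · exact (Real.lt_log_iff_exp_lt hb0').2 hbhalf
    · intro p hp hpd
      exact hrlt.trans_le (hloghelper p hp (hdq p hp hpd))

lemma apply_le_exp_of_rough {f : ℕ → ℝ} {A1 l Q : ℝ} {A2 : ℝ → ℝ} (hf : MultNonneg f)
    (hM : InM f A1 A2) (hA1 : 0 < A1) (hl : 0 ≤ l) (hAl : A1 ≤ Real.exp l) (hQ : 0 < Q) {d : ℕ}
    (hd : d ≠ 0) (hdQ : ∀ p : ℕ, p.Prime → p ∣ d → Q ≤ Real.log p) :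
    f d ≤ Real.exp (l * (Real.log d / Q)) := by
  have hlog : Real.log d = ∑ p ∈ d.primeFactors, d.factorization p * Real.log p := by
    conv_lhs => rw [← Nat.prod_factorization_pow_eq_self hd]
    rw [Finsupp.prod, Nat.support_factorization, Nat.cast_prod, Real.log_prod]
    · simp
    · intro p hp
      exact_mod_cast pow_ne_zero _ (Nat.prime_of_mem_primeFactors hp).ne_zero
  rw [Nat.multiplicative_factorization f hf.2.2 hf.2.1 hd, Finsupp.prod, Nat.support_factorization,
    hlog, sum_div, mul_sum, Real.exp_sum]
  refine prod_le_prod (fun p _ => hf.1 _) fun p hp => ?_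
  have hpp := Nat.prime_of_mem_primeFactors hp
  have hpd := Nat.dvd_of_mem_primeFactors hp
  have hv : 1 ≤ d.factorization p := hpp.factorization_pos_of_dvd hd hpd
  have h1 : 1 ≤ Real.log p / Q := by
    rw [le_div_iff₀ hQ, one_mul]
    exact hdQ p hpp hpd
  calc f (p ^ d.factorization p) ≤ A1 ^ d.factorization p := hM.1 p hpp _ hv
    _ ≤ Real.exp l ^ d.factorization p := by gcongr
    _ = Real.exp (d.factorization p * l) := (Real.exp_nat_mul _ _).symm
    _ ≤ _ := by
        rw [Real.exp_le_exp]
        calc (d.factorization p : ℝ) * l = l * d.factorization p * 1 := by ring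
          _ ≤ l * d.factorization p * (Real.log p / Q) := by gcongr
          _ = _ := by ring

/-! ### Counting in arithmetic progressions -/

lemma sum_Ioc_floor_inv_sq_le {M : ℝ} (hM : 1 ≤ M) (n : ℕ) :
    ∑ m ∈ Ioc ⌊M⌋₊ n, ((m : ℝ) ^ 2)⁻¹ ≤ 2 / M := by
  have hfl : 1 ≤ ⌊M⌋₊ := Nat.le_floor (by simpa using hM)
  have hflr : (1 : ℝ) ≤ (⌊M⌋₊ : ℝ) := by exact_mod_cast hfl
  rcases Nat.le_total ⌊M⌋₊ n with h | h
  · have h1 := sum_Ioc_inv_sq_le_sub (α := ℝ) (by omega : ⌊M⌋₊ ≠ 0) h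
    have h2 : (0 : ℝ) ≤ (n : ℝ)⁻¹ := by positivity
    have h3 : ((⌊M⌋₊ : ℝ))⁻¹ ≤ 2 / M := by
      rw [inv_eq_one_div, div_le_div_iff₀ (by linarith) (by linarith)]
      linarith [Nat.lt_floor_add_one M]
    linarith
  · rw [Ioc_eq_empty (by omega), sum_empty]
    positivity

open Classical in
/-- Few integers of a reduced residue class have a large square divisor. -/
lemma card_sq_dvd_le (N L : ℕ) {a k : ℕ} {M z : ℝ} (hk : 0 < k) (ha : a.Coprime k) (hM : 1 ≤ M)
    (hL : z ^ 2 * k ≤ L) :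
    (#{n ∈ Ico N (N + L) | n ≡ a [MOD k] ∧ ∃ m : ℕ, M < m ∧ (m : ℝ) ≤ z ∧ m ^ 2 ∣ n} : ℝ)
      ≤ 4 * (L / (k * M)) := by
  have hkr : (0 : ℝ) < k := by exact_mod_cast hk
  have hsub : ({n ∈ Ico N (N + L) | n ≡ a [MOD k] ∧
        ∃ m : ℕ, M < m ∧ (m : ℝ) ≤ z ∧ m ^ 2 ∣ n} : Finset ℕ)
      ⊆ (Ioc ⌊M⌋₊ ⌊z⌋₊).biUnion fun m => {n ∈ Ico N (N + L) | n ≡ a [MOD k] ∧ m ^ 2 ∣ n} := by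
    intro n hn
    simp only [mem_filter, mem_biUnion] at hn ⊢
    obtain ⟨h1, h2, m, hm1, hm2, hm3⟩ := hn
    refine ⟨m, mem_Ioc.2 ⟨?_, Nat.le_floor hm2⟩, h1, h2, hm3⟩
    exact (Nat.floor_lt (by linarith)).2 hm1
  have hpt : ∀ m ∈ Ioc ⌊M⌋₊ ⌊z⌋₊,
      (#{n ∈ Ico N (N + L) | n ≡ a [MOD k] ∧ m ^ 2 ∣ n} : ℝ) ≤ 2 * (L / k) * ((m : ℝ) ^ 2)⁻¹ := by
    intro m hm
    rw [mem_Ioc] at hm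
    have hm0 : 0 < m := by omega
    have hmr : (0 : ℝ) < m := by exact_mod_cast hm0
    have hmz : (m : ℝ) ≤ z := (Nat.le_floor_iff' hm0.ne').1 hm.2
    by_cases hmk : (m ^ 2).Coprime k
    · have h1 := abs_card_filter_modEq_dvd_sub_le N L a hk (pow_pos hm0 2) hmk
      rw [abs_le] at h1
      have h2 : (1 : ℝ) ≤ L / (k * (m ^ 2 : ℕ)) := by
        rw [le_div_iff₀ (by positivity), one_mul]
        push_cast
        calc (k : ℝ) * m ^ 2 ≤ k * z ^ 2 := by gcongr
          _ ≤ (L : ℝ) := by linarith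
      have h3 : (2 : ℝ) * (L / k) * ((m : ℝ) ^ 2)⁻¹ = 2 * (L / (k * (m ^ 2 : ℕ))) := by
        push_cast
        field_simp
      rw [h3]
      linarith [h1.2]
    · have : ({n ∈ Ico N (N + L) | n ≡ a [MOD k] ∧ m ^ 2 ∣ n} : Finset ℕ) = ∅ := by
        refine filter_eq_empty_iff.2 fun n _ h => hmk ?_
        have hnk : n.Coprime k := by
          rw [Nat.Coprime, h.1.gcd_eq]
          exact ha
        exact Nat.Coprime.coprime_dvd_left h.2 hnk
      rw [this, card_empty, Nat.cast_zero]
      positivity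
  calc _ ≤ ((#((Ioc ⌊M⌋₊ ⌊z⌋₊).biUnion fun m =>
        {n ∈ Ico N (N + L) | n ≡ a [MOD k] ∧ m ^ 2 ∣ n}) : ℕ) : ℝ) := by
        exact_mod_cast card_le_card hsub
    _ ≤ ∑ m ∈ Ioc ⌊M⌋₊ ⌊z⌋₊, (#{n ∈ Ico N (N + L) | n ≡ a [MOD k] ∧ m ^ 2 ∣ n} : ℝ) := by
        exact_mod_cast card_biUnion_le
    _ ≤ ∑ m ∈ Ioc ⌊M⌋₊ ⌊z⌋₊, 2 * (L / k) * ((m : ℝ) ^ 2)⁻¹ := sum_le_sum hpt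
    _ = 2 * (L / k) * ∑ m ∈ Ioc ⌊M⌋₊ ⌊z⌋₊, ((m : ℝ) ^ 2)⁻¹ := by rw [mul_sum]
    _ ≤ 2 * (L / k) * (2 / M) := by
        gcongr
        exact sum_Ioc_floor_inv_sq_le hM _
    _ = _ := by field_simp; ring

open Classical in
/-- Multiples `b * m` of `b` in a reduced residue class, with `m` free of small prime factors. -/
lemma card_rough_multiples_le (N L : ℕ) {a k b : ℕ} {u : ℝ} (hk : 0 < k) (ha : a.Coprime k)
    (hb : 0 < b) (hu : 2 ≤ u) (hL : Real.exp (5 * u) * k * b ≤ L) :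
    (#{n ∈ Ico N (N + L) | n ≡ a [MOD k] ∧
        ∃ m : ℕ, n = b * m ∧ ∀ p : ℕ, p.Prime → p ∣ m → u < Real.log p} : ℝ)
      ≤ 18 * (L / (b * (Nat.totient k * u))) := by
  have hkr : (1 : ℝ) ≤ k := by exact_mod_cast hk
  have hbr : (0 : ℝ) < b := by exact_mod_cast hb
  have hphi : (0 : ℝ) < Nat.totient k := by exact_mod_cast Nat.totient_pos.2 hk
  set X : Finset ℕ := {n ∈ Ico N (N + L) | n ≡ a [MOD k] ∧
        ∃ m : ℕ, n = b * m ∧ ∀ p : ℕ, p.Prime → p ∣ m → u < Real.log p} with hX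
  rcases X.eq_empty_or_nonempty with hemp | ⟨n₀, hn₀⟩
  · rw [hemp, card_empty, Nat.cast_zero]
    positivity
  rw [hX, mem_filter] at hn₀
  obtain ⟨_, hn₀a, c, hc, _⟩ := hn₀
  have hbk : b.Coprime k := by
    have hnk : n₀.Coprime k := by
      rw [Nat.Coprime, hn₀a.gcd_eq]
      exact ha
    exact Nat.Coprime.coprime_dvd_left ⟨c, hc⟩ hnk
  set D := ⌊Real.exp u⌋₊ with hD
  have hDle : (D : ℝ) ≤ Real.exp u := Nat.floor_le (Real.exp_pos u).le
  have hhalf : (2 : ℝ) ≤ Real.exp (u / 2) := by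
    have := Real.add_one_le_exp (u / 2)
    linarith
  have hDge : Real.exp (u / 2) ≤ D := by
    have h1 : Real.exp u = Real.exp (u / 2) * Real.exp (u / 2) := by
      rw [← Real.exp_add]; congr 1; ring
    have h2 := Nat.lt_floor_add_one (Real.exp u)
    rw [← hD] at h2
    nlinarith
  have hD2 : 2 ≤ D := by exact_mod_cast hhalf.trans hDge
  have hlogD : u / 2 ≤ Real.log D := by
    rw [Real.le_log_iff_exp_le (by linarith)]
    exact hDge
  have hDL : D ^ 5 * k * b ≤ L := by
    have : (D : ℝ) ^ 5 * k * b ≤ L := by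
      refine le_trans ?_ hL
      have : Real.exp (5 * u) = Real.exp u ^ 5 := by
        rw [← Real.exp_nat_mul]; norm_num
      rw [this]
      gcongr
    exact_mod_cast this
  have hDL' : D ^ 5 * k ≤ L / b := (Nat.le_div_iff_mul_le hb).2 hDL
  have hsieve := card_sifted_le (N / b) (L / b + 2) c hk hD2 (by omega)
  have hcard : #X ≤ #{n ∈ Ico (N / b) (N / b + (L / b + 2)) | n ≡ c [MOD k] ∧
      ∀ p : ℕ, p.Prime → p ∣ n → p ∣ k ∨ D < p} := by
    refine card_le_card_of_injOn (fun n => n / b) ?_ ?_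
    · intro n hn
      rw [mem_coe, hX, mem_filter] at hn
      obtain ⟨hnI, hna, m, rfl, hm⟩ := hn
      rw [mem_Ico] at hnI
      rw [mem_coe, mem_filter]
      simp only [Nat.mul_div_cancel_left m hb]
      refine ⟨mem_Ico.2 ⟨?_, ?_⟩, ?_, ?_⟩
      · exact Nat.div_le_of_le_mul hnI.1
      · have h1 := Nat.lt_div_mul_add (a := N) hb
        have h2 := Nat.lt_div_mul_add (a := L) hb
        have h3 : b * m < b * (N / b + (L / b + 2)) := by
          calc b * m < N + L := hnI.2
            _ ≤ N / b * b + b + (L / b * b + b) := by omega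
            _ = _ := by ring
        exact Nat.lt_of_mul_lt_mul_left h3
      · refine Nat.ModEq.cancel_left_of_coprime hbk.symm ?_
        rw [← hc]
        exact hna.trans hn₀a.symm
      · intro p hp hpm
        refine Or.inr ?_
        have h1 := hm p hp hpm
        rw [Real.lt_log_iff_exp_lt (by exact_mod_cast hp.pos)] at h1
        exact_mod_cast hDle.trans_lt h1
    · intro n hn n' hn' h
      rw [mem_coe, hX, mem_filter] at hn hn'
      obtain ⟨_, _, m, rfl, _⟩ := hn
      obtain ⟨_, _, m', rfl, _⟩ := hn'
      simp only [Nat.mul_div_cancel_left _ hb] at h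
      rw [h]
  have hLb : ((L / b + 2 : ℕ) : ℝ) ≤ 3 * (L / b) := by
    have h1 : ((L / b : ℕ) : ℝ) ≤ L / b := Nat.cast_div_le
    have h2 : (1 : ℝ) ≤ L / b := by
      rw [le_div_iff₀ hbr, one_mul]
      refine le_trans ?_ hL
      have h3 : 1 ≤ Real.exp (5 * u) := Real.one_le_exp (by linarith)
      exact le_mul_of_one_le_left hbr.le (one_le_mul_of_one_le_of_one_le h3 hkr)
    push_cast
    linarith
  calc (#X : ℝ) ≤ _ := by exact_mod_cast hcard
    _ ≤ _ := hsieve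
    _ ≤ 3 * (3 * (L / b) / (Nat.totient k * (u / 2))) := by gcongr
    _ = _ := by field_simp; ring

open Classical in
/-- The contribution of the integers `b * m`, with `b` being `exp (Z / r)`-smooth and `m`
free of prime factors up to `exp (Z / (r + 1))`. -/
lemma sum_smooth_mul_card_le {f : ℕ → ℝ} {A1 : ℝ} {A2 : ℝ → ℝ} (hf : MultNonneg f)
    (hM : InM f A1 A2) (hA1 : 0 < A1) (N L : ℕ) {a k r : ℕ} {K Z x : ℝ} (hk : 0 < k)
    (ha : a.Coprime k) (hK : 2 ≤ K) (hr : 1 ≤ r) (hrZ : 8 * K * r ≤ Z)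
    (hL : Real.exp (4 * Z) * k ≤ L) (hx : Real.exp Z ≤ x) (B : Finset ℕ)
    (hB : ∀ b ∈ B, 0 < b ∧ b.Coprime k ∧ Real.log b ≤ Z ∧
      (∀ p : ℕ, p.Prime → p ∣ b → Real.log p ≤ Z / r) ∧ (2 ≤ r → Z / 2 < Real.log b)) :
    ∑ b ∈ B, f b * (#{n ∈ Ico N (N + L) | n ≡ a [MOD k] ∧
        ∃ m : ℕ, n = b * m ∧ ∀ p : ℕ, p.Prime → p ∣ m → Z / (r + 1) < Real.log p} : ℝ)
      ≤ 18 * (L / (Nat.totient k * Z)) * ((r + 1) * Real.exp (K / 2 * (1 - r))) *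
        (Real.exp (3 * A1 * K * Real.exp K
          + 4 * |A2 (1 / 8)| * ∑' n : ℕ, 1 / (n : ℝ) ^ (3 / 2 : ℝ)) *
        Real.exp (∑ p ∈ Icc 1 ⌊x⌋₊ with (p.Prime ∧ ¬ p ∣ k), f p / p)) := by
  have hr1 : (1 : ℝ) ≤ r := by exact_mod_cast hr
  have hr0 : (0 : ℝ) < r := by linarith
  have hphi : (0 : ℝ) < Nat.totient k := by exact_mod_cast Nat.totient_pos.2 hk
  have hZ16 : 16 * r ≤ Z := by nlinarith
  have hZ0 : 0 < Z := by linarith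
  have hW : 8 * K ≤ Z / r := by rwa [le_div_iff₀ hr0]
  have hsmooth := sum_smooth_le hf hM hA1 (by linarith : 0 < K) hW (by linarith) k B
    (fun b hb => ⟨(hB b hb).1, (hB b hb).2.1, (hB b hb).2.2.2.1⟩)
  have hexp : ∑ p ∈ Icc 1 ⌊Real.exp (Z / r)⌋₊ with (p.Prime ∧ ¬ p ∣ k), f p / p
      ≤ ∑ p ∈ Icc 1 ⌊x⌋₊ with (p.Prime ∧ ¬ p ∣ k), f p / p := by
    refine sum_le_sum_of_subset_of_nonneg (filter_subset_filter _ (Icc_subset_Icc le_rfl ?_))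
      fun p _ _ => div_nonneg (hf.1 p) (Nat.cast_nonneg p)
    refine Nat.floor_le_floor (le_trans (Real.exp_le_exp.2 ?_) hx)
    exact div_le_self hZ0.le hr1
  set δ := K / (Z / r) with hδ
  have hpt : ∀ b ∈ B, f b * (#{n ∈ Ico N (N + L) | n ≡ a [MOD k] ∧
        ∃ m : ℕ, n = b * m ∧ ∀ p : ℕ, p.Prime → p ∣ m → Z / (r + 1) < Real.log p} : ℝ)
      ≤ 18 * (L / (Nat.totient k * Z)) * ((r + 1) * Real.exp (K / 2 * (1 - r))) *
        (f b * (b : ℝ) ^ (δ - 1)) := by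
    intro b hb
    obtain ⟨hb0, hbk, hbZ, hbp, hbr⟩ := hB b hb
    have hb0r : (0 : ℝ) < b := by exact_mod_cast hb0
    have hb1r : (1 : ℝ) ≤ b := by exact_mod_cast hb0
    have hu : 2 ≤ Z / (r + 1) := by
      rw [le_div_iff₀ (by linarith)]
      linarith
    have h5 : Real.exp (5 * (Z / (r + 1))) * k * b ≤ L := by
      have h6 : (b : ℝ) ≤ Real.exp Z := (Real.log_le_iff_le_exp hb0r).1 hbZ
      have h7 : Z / (r + 1) ≤ Z / 2 := by gcongr; linarith
      have h10 : Real.exp (5 * (Z / (r + 1))) ≤ Real.exp (3 * Z) :=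
        Real.exp_le_exp.2 (by linarith)
      calc Real.exp (5 * (Z / (r + 1))) * k * b ≤ Real.exp (3 * Z) * k * Real.exp Z := by
            gcongr
        _ = Real.exp (3 * Z) * Real.exp Z * k := by ring
        _ = Real.exp (4 * Z) * k := by rw [← Real.exp_add]; congr 2; ring
        _ ≤ L := hL
    have h8 := card_rough_multiples_le N L hk ha hb0 hu h5
    have h9 : 1 ≤ Real.exp (K / 2 * (1 - r)) * (b : ℝ) ^ δ := by
      rw [Real.rpow_def_of_pos hb0r, ← Real.exp_add]
      apply Real.one_le_exp
      have hlogb : 0 ≤ Real.log b := Real.log_natCast_nonneg b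
      rcases Nat.lt_or_ge r 2 with h | h
      · have : r = 1 := by omega
        subst this
        have : 0 ≤ δ := by rw [hδ]; positivity
        norm_num
        positivity
      · have h10 : Z / 2 * δ = K / 2 * r := by rw [hδ]; field_simp
        have h11 : Z / 2 * δ ≤ Real.log b * δ := by
          have : 0 ≤ δ := by rw [hδ]; positivity
          gcongr
          exact (hbr h).le
        linarith
    have hfb := hf.1 b
    calc f b * _ ≤ f b * (18 * (L / (b * (Nat.totient k * (Z / (r + 1)))))) := by gcongr
      _ ≤ f b * (18 * (L / (b * (Nat.totient k * (Z / (r + 1)))))) *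
          (Real.exp (K / 2 * (1 - r)) * (b : ℝ) ^ δ) :=
          le_mul_of_one_le_right (by positivity) h9
      _ = _ := by
          rw [Real.rpow_sub_one hb0r.ne']
          field_simp
  calc _ ≤ _ := sum_le_sum hpt
    _ = 18 * (L / (Nat.totient k * Z)) * ((r + 1) * Real.exp (K / 2 * (1 - r))) *
        ∑ b ∈ B, f b * (b : ℝ) ^ (δ - 1) := by rw [mul_sum]
    _ ≤ _ := by
        gcongr
        refine hsmooth.trans ?_
        gcongr

/-! ### The two ranges -/

lemma sum_Icc_exp_neg_le_one (R : ℕ) : ∑ r ∈ Icc 1 R, Real.exp (-(r : ℝ)) ≤ 1 := by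
  have hhalf : Real.exp (-1) ≤ 1 / 2 := by
    rw [Real.exp_neg, inv_eq_one_div]
    have := Real.add_one_le_exp (1 : ℝ)
    gcongr
    linarith
  have h : ∀ R : ℕ, ∑ r ∈ Icc 1 R, Real.exp (-(r : ℝ)) ≤ 1 - (1 / 2) ^ R := by
    intro R
    induction R with
    | zero => simp
    | succ R ih =>
      rw [sum_Icc_succ_top (by omega)]
      have h1 : Real.exp (-((R + 1 : ℕ) : ℝ)) ≤ (1 / 2) ^ (R + 1) := by
        calc Real.exp (-((R + 1 : ℕ) : ℝ)) = Real.exp (-1) ^ (R + 1) := by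
              rw [← Real.exp_nat_mul]; congr 1; ring
          _ ≤ _ := by gcongr
      rw [pow_succ] at h1 ⊢
      linarith
  have := h R
  have h2 : (0 : ℝ) ≤ (1 / 2) ^ R := by positivity
  linarith

open Classical in
/-- The contribution of the integers without large square divisors. -/
lemma sum_not_sq_dvd_le {f : ℕ → ℝ} {A1 : ℝ} {A2 : ℝ → ℝ} (hf : MultNonneg f)
    (hM : InM f A1 A2) (hA1 : 0 < A1) (N L : ℕ) {a k W₀ : ℕ} {K Z x l c : ℝ} (hk : 0 < k)
    (ha : a.Coprime k) (hl : 0 ≤ l) (hAl : A1 ≤ Real.exp l) (hc : 0 ≤ c)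
    (hK : 2 * (l * c + 2) ≤ K) (hZ : 8 * K ≤ Z) (hW₀ : Real.exp (8 * K) ≤ W₀)
    (hWZ : (W₀ : ℝ) ≤ Real.exp (Z / (8 * W₀))) (hL : Real.exp (4 * Z) * k ≤ L)
    (hx : Real.exp Z ≤ x) (T : Finset ℕ)
    (hT : ∀ n ∈ T, n ∈ Ico N (N + L) ∧ n ≡ a [MOD k] ∧ Real.exp Z < n ∧ Real.log n ≤ c * Z ∧
      ∀ m : ℕ, Real.exp (Z / (8 * W₀)) < m → (m : ℝ) ≤ Real.exp Z → ¬ m ^ 2 ∣ n) :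
    ∑ n ∈ T, f n ≤ 18 * (L / (Nat.totient k * Z)) * Real.exp (2 * (l * c) + 2) *
        (Real.exp (3 * A1 * K * Real.exp K
          + 4 * |A2 (1 / 8)| * ∑' n : ℕ, 1 / (n : ℝ) ^ (3 / 2 : ℝ)) *
        Real.exp (∑ p ∈ Icc 1 ⌊x⌋₊ with (p.Prime ∧ ¬ p ∣ k), f p / p)) := by
  have hlc : 0 ≤ l * c := mul_nonneg hl hc
  have hK4 : 4 ≤ K := by linarith
  have hZ0 : 0 < Z := by linarith
  set G := Real.exp (3 * A1 * K * Real.exp K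
          + 4 * |A2 (1 / 8)| * ∑' n : ℕ, 1 / (n : ℝ) ^ (3 / 2 : ℝ)) *
        Real.exp (∑ p ∈ Icc 1 ⌊x⌋₊ with (p.Prime ∧ ¬ p ∣ k), f p / p) with hG
  have hG0 : 0 ≤ G := by positivity
  set R := ⌊Z / (8 * K)⌋₊ with hR
  let B : ℕ → Finset ℕ := fun r => {b ∈ Icc 1 ⌊Real.exp Z⌋₊ | b.Coprime k ∧
    (∀ p : ℕ, p.Prime → p ∣ b → Real.log p ≤ Z / r) ∧ (2 ≤ r → Z / 2 < Real.log b)}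
  let X : ℕ → ℕ → Finset ℕ := fun r b => {n ∈ Ico N (N + L) | n ≡ a [MOD k] ∧
    ∃ m : ℕ, n = b * m ∧ ∀ p : ℕ, p.Prime → p ∣ m → Z / (r + 1) < Real.log p}
  have hcover : ∀ n ∈ T, ∃ r ∈ Icc 1 R, ∃ b ∈ B r,
      n ∈ X r b ∧ f n ≤ Real.exp (l * c * (r + 1)) * f b := by
    intro n hn
    obtain ⟨hnI, hna, hZn, hlogn, hsq⟩ := hT n hn
    obtain ⟨r, b, d, hr, hrZ, hnbd, hbd, hbZ, hbp, hbr, hdp⟩ :=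
      exists_smooth_mul_rough (by linarith) hZ hW₀ hWZ hZn hsq
    have hn0 : n ≠ 0 := by
      rintro rfl
      exact absurd hZn (by simpa using (Real.exp_pos Z).le)
    have hb0 : b ≠ 0 := by rintro rfl; simp at hnbd; exact hn0 hnbd
    have hd0 : d ≠ 0 := by rintro rfl; simp at hnbd; exact hn0 hnbd
    have hnk : n.Coprime k := by
      rw [Nat.Coprime, hna.gcd_eq]
      exact ha
    have hr1 : (0 : ℝ) < r + 1 := by positivity
    refine ⟨r, mem_Icc.2 ⟨hr, Nat.le_floor ?_⟩, b, ?_, ?_, ?_⟩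
    · rw [le_div_iff₀ (by linarith)]
      linarith
    · refine mem_filter.2 ⟨mem_Icc.2 ⟨Nat.one_le_iff_ne_zero.2 hb0, Nat.le_floor ?_⟩, ?_, hbp, hbr⟩
      · exact (Real.log_le_iff_le_exp (by positivity)).1 hbZ
      · exact Nat.Coprime.coprime_dvd_left ⟨d, hnbd⟩ hnk
    · exact mem_filter.2 ⟨hnI, hna, d, hnbd, hdp⟩
    · have h1 := apply_le_exp_of_rough hf hM hA1 hl hAl (by positivity : 0 < Z / (r + 1)) hd0
        (fun p hp hpd => (hdp p hp hpd).le)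
      have h2 : Real.log d ≤ Real.log n := by
        refine Real.log_le_log (by positivity) ?_
        exact_mod_cast Nat.le_of_dvd (Nat.pos_of_ne_zero hn0) ⟨b, by rw [hnbd, mul_comm]⟩
      have h3 : Real.log d / (Z / (r + 1)) ≤ c * (r + 1) := by
        rw [div_le_iff₀ (by positivity)]
        calc Real.log d ≤ c * Z := h2.trans hlogn
          _ = _ := by field_simp
      rw [hnbd, hf.2.2 b d hbd, mul_comm]
      refine mul_le_mul_of_nonneg_right (h1.trans (Real.exp_le_exp.2 ?_)) (hf.1 b)
      rw [mul_assoc]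
      gcongr
  have hpt : ∀ n ∈ T, f n ≤ ∑ r ∈ Icc 1 R, ∑ b ∈ B r,
      if n ∈ X r b then Real.exp (l * c * (r + 1)) * f b else 0 := by
    intro n hn
    obtain ⟨r, hr, b, hb, hX, hfn⟩ := hcover n hn
    have hnn : ∀ r b : ℕ, 0 ≤ if n ∈ X r b then Real.exp (l * c * (r + 1)) * f b else 0 := by
      intro r b
      have := hf.1 b
      positivity
    calc f n ≤ if n ∈ X r b then Real.exp (l * c * (r + 1)) * f b else 0 := by rwa [if_pos hX]
      _ ≤ ∑ b ∈ B r, if n ∈ X r b then Real.exp (l * c * (r + 1)) * f b else 0 :=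
          single_le_sum (f := fun b => if n ∈ X r b then Real.exp (l * c * (r + 1)) * f b else 0)
            (fun b _ => hnn r b) hb
      _ ≤ _ := single_le_sum (f := fun r : ℕ => ∑ b ∈ B r,
            if n ∈ X r b then Real.exp (l * c * (r + 1)) * f b else 0)
            (fun r _ => sum_nonneg fun b _ => hnn r b) hr
  have hrange : ∀ r ∈ Icc 1 R,
      ∑ b ∈ B r, Real.exp (l * c * (r + 1)) * (f b * (#(X r b) : ℝ))
        ≤ 18 * (L / (Nat.totient k * Z)) * Real.exp (2 * (l * c) + 2) * G *
          Real.exp (-(r : ℝ)) := by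
    intro r hr
    rw [mem_Icc] at hr
    have hr1 : (1 : ℝ) ≤ r := by exact_mod_cast hr.1
    have hrZ : 8 * K * r ≤ Z := by
      have h1 : (r : ℝ) ≤ Z / (8 * K) := (Nat.le_floor_iff (by positivity)).1 hr.2
      rw [le_div_iff₀ (by linarith)] at h1
      linarith
    have hmain := sum_smooth_mul_card_le hf hM hA1 N L (x := x) hk ha (by linarith) hr.1 hrZ hL hx
      (B r) (by
        intro b hb
        simp only [B, mem_filter, mem_Icc] at hb
        obtain ⟨⟨hb1, hb2⟩, hbk, hbp, hbr⟩ := hb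
        refine ⟨hb1, hbk, ?_, hbp, hbr⟩
        rw [Real.log_le_iff_le_exp (by exact_mod_cast hb1)]
        exact (Nat.le_floor_iff (Real.exp_pos Z).le).1 hb2)
    have hexp : Real.exp (l * c * (r + 1)) * ((r + 1) * Real.exp (K / 2 * (1 - r)))
        ≤ Real.exp (2 * (l * c) + 2) * Real.exp (-(r : ℝ)) := by
      calc Real.exp (l * c * (r + 1)) * ((r + 1) * Real.exp (K / 2 * (1 - r)))
          ≤ Real.exp (l * c * (r + 1)) * (Real.exp r * Real.exp (K / 2 * (1 - r))) := by
            gcongr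
            exact Real.add_one_le_exp _
        _ = Real.exp (l * c * (r + 1) + (r + K / 2 * (1 - r))) := by
            rw [Real.exp_add, Real.exp_add]
        _ ≤ Real.exp (2 * (l * c) + 2 + -(r : ℝ)) := by
            refine Real.exp_le_exp.2 ?_
            nlinarith
        _ = _ := Real.exp_add _ _
    rw [← mul_sum]
    calc _ ≤ Real.exp (l * c * (r + 1)) * (18 * (L / (Nat.totient k * Z)) *
          ((r + 1) * Real.exp (K / 2 * (1 - r))) * G) := by gcongr
      _ = 18 * (L / (Nat.totient k * Z)) * G *
          (Real.exp (l * c * (r + 1)) * ((r + 1) * Real.exp (K / 2 * (1 - r)))) := by ring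
      _ ≤ 18 * (L / (Nat.totient k * Z)) * G *
          (Real.exp (2 * (l * c) + 2) * Real.exp (-(r : ℝ))) := by gcongr
      _ = _ := by ring
  calc ∑ n ∈ T, f n ≤ ∑ n ∈ T, ∑ r ∈ Icc 1 R, ∑ b ∈ B r,
        (if n ∈ X r b then Real.exp (l * c * (r + 1)) * f b else 0) := sum_le_sum hpt
    _ = ∑ r ∈ Icc 1 R, ∑ b ∈ B r, ∑ n ∈ T,
        (if n ∈ X r b then Real.exp (l * c * (r + 1)) * f b else 0) := by
        rw [sum_comm]
        exact sum_congr rfl fun r _ => sum_comm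
    _ ≤ ∑ r ∈ Icc 1 R, ∑ b ∈ B r, Real.exp (l * c * (r + 1)) * (f b * (#(X r b) : ℝ)) := by
        refine sum_le_sum fun r _ => sum_le_sum fun b _ => ?_
        have hfb := hf.1 b
        rw [← sum_filter, sum_const, nsmul_eq_mul]
        have : #{n ∈ T | n ∈ X r b} ≤ #(X r b) := card_le_card fun n hn => (mem_filter.1 hn).2
        calc (#{n ∈ T | n ∈ X r b} : ℝ) * (Real.exp (l * c * (r + 1)) * f b)
            ≤ #(X r b) * (Real.exp (l * c * (r + 1)) * f b) := by gcongr
          _ = _ := by ring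
    _ ≤ ∑ r ∈ Icc 1 R, 18 * (L / (Nat.totient k * Z)) * Real.exp (2 * (l * c) + 2) * G *
          Real.exp (-(r : ℝ)) := sum_le_sum hrange
    _ ≤ 18 * (L / (Nat.totient k * Z)) * Real.exp (2 * (l * c) + 2) * G * 1 := by
        rw [← mul_sum]
        gcongr
        exact sum_Icc_exp_neg_le_one R
    _ = _ := mul_one _

open Classical in
/-- The contribution of the integers with a large square divisor. -/
lemma sum_sq_dvd_le {f : ℕ → ℝ} {A1 : ℝ} {A2 : ℝ → ℝ} (hM : InM f A1 A2) (N L : ℕ) {a k : ℕ}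
    {θ u M z : ℝ} (hk : 0 < k) (ha : a.Coprime k) (hθ : 0 < θ) (hu : 0 < u)
    (hMu : Real.exp (θ * u) ≤ M) (hL : z ^ 2 * k ≤ L) (T : Finset ℕ)
    (hT : ∀ n ∈ T, 0 < n ∧ n ∈ Ico N (N + L) ∧ n ≡ a [MOD k] ∧ Real.log n ≤ 2 * u ∧
      ∃ m : ℕ, M < m ∧ (m : ℝ) ≤ z ∧ m ^ 2 ∣ n) :
    ∑ n ∈ T, f n ≤ 8 * |A2 (θ / 4)| / θ * (L / (Nat.totient k * u)) := by
  have hkr : (0 : ℝ) < k := by exact_mod_cast hk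
  have hphi : (0 : ℝ) < Nat.totient k := by exact_mod_cast Nat.totient_pos.2 hk
  have hphik : (Nat.totient k : ℝ) ≤ k := by exact_mod_cast Nat.totient_le k
  have hM1 : 1 ≤ M := (Real.one_le_exp (by positivity)).trans hMu
  have hf : ∀ n ∈ T, f n ≤ |A2 (θ / 4)| * Real.exp (θ * u / 2) := by
    intro n hn
    obtain ⟨hn0, -, -, hlog, -⟩ := hT n hn
    refine (hM.2 (θ / 4) (by positivity) n hn0).trans ?_
    rw [Real.rpow_def_of_pos (by exact_mod_cast hn0)]
    gcongr
    · exact le_abs_self _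
    · nlinarith
  have hcard := card_sq_dvd_le N L hk ha hM1 hL
  have hsub : (#T : ℝ) ≤ 4 * (L / (k * M)) := by
    refine le_trans ?_ hcard
    exact_mod_cast card_le_card fun n hn => by
      obtain ⟨-, h1, h2, -, h3⟩ := hT n hn
      exact mem_filter.2 ⟨h1, h2, h3⟩
  have hinv : Real.exp (-(θ * u / 2)) ≤ 2 / (θ * u) := by
    rw [Real.exp_neg, inv_eq_one_div, div_le_div_iff₀ (Real.exp_pos _) (by positivity)]
    linarith [Real.add_one_le_exp (θ * u / 2)]
  calc ∑ n ∈ T, f n ≤ #T * (|A2 (θ / 4)| * Real.exp (θ * u / 2)) := by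
        rw [← nsmul_eq_mul]
        exact sum_le_card_nsmul _ _ _ hf
    _ ≤ 4 * (L / (Nat.totient k * Real.exp (θ * u))) *
        (|A2 (θ / 4)| * Real.exp (θ * u / 2)) := by
        gcongr
        refine hsub.trans ?_
        gcongr
    _ = 4 * |A2 (θ / 4)| * (L / Nat.totient k) * Real.exp (-(θ * u / 2)) := by
        have : Real.exp (θ * u) = Real.exp (θ * u / 2) * Real.exp (θ * u / 2) := by
          rw [← Real.exp_add]; congr 1; ring
        rw [this, Real.exp_neg]
        field_simp
    _ ≤ 4 * |A2 (θ / 4)| * (L / Nat.totient k) * (2 / (θ * u)) := by gcongr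
    _ = _ := by field_simp; ring

set_option maxHeartbeats 1000000 in
/-- Shiu's Brun–Titchmarsh theorem for multiplicative functions. -/
theorem shiu_theorem (α κ : ℝ) (hα : 0 < α) (hα' : α < 1/2)
    (hκ : 0 < κ) (hκ' : κ < 1/2) (A1 : ℝ) (hA1 : 0 < A1) (A2 : ℝ → ℝ) :
    ∃ C : ℝ, 0 < C ∧ ∃ x0 : ℝ, ∀ x : ℝ, x0 ≤ x →
      ∀ f : ℕ → ℝ, MultNonneg f → InM f A1 A2 →
      ∀ y : ℝ, x ^ κ ≤ y → y ≤ x →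
      ∀ k : ℕ, 1 ≤ k → (k : ℝ) < y ^ (1 - α) →
      ∀ a : ℕ, Nat.gcd a k = 1 →
      ∑ n ∈ (Finset.Icc 1 ⌊x + y⌋₊).filter
          (fun n : ℕ => x ≤ (n : ℝ) ∧ (n : ℝ) < x + y ∧ n % k = a % k), f n
        ≤ C * (y / ((Nat.totient k : ℝ) * Real.log x)) *
          Real.exp (∑ p ∈ (Finset.Icc 1 ⌊x⌋₊).filter
              (fun p : ℕ => p.Prime ∧ ¬ p ∣ k), f p / (p : ℝ)) := by
  classical
  set l := Real.log (max A1 1) with hl_def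
  have hl : 0 ≤ l := Real.log_nonneg (le_max_right _ _)
  have hAl : A1 ≤ Real.exp l := by
    rw [hl_def, Real.exp_log (by positivity)]
    exact le_max_left _ _
  have hακ : 0 < α * κ := mul_pos hα hκ
  set c := 8 / (α * κ) with hc_def
  have hc : 0 < c := by positivity
  set K := 2 * (l * c + 2) with hK_def
  have hK : 4 ≤ K := by
    have : 0 ≤ l * c := by positivity
    linarith
  set W₀ := ⌈Real.exp (8 * K)⌉₊ with hW₀_def
  have hW₀ : Real.exp (8 * K) ≤ W₀ := Nat.le_ceil _
  have hKW : 8 * K ≤ W₀ := by linarith [Real.add_one_le_exp (8 * K)]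
  have hW1 : (1 : ℝ) ≤ W₀ := by linarith
  set θ := α * κ / (32 * W₀) with hθ_def
  have hθ : 0 < θ := by positivity
  set E := Real.exp (3 * A1 * K * Real.exp K
    + 4 * |A2 (1 / 8)| * ∑' n : ℕ, 1 / (n : ℝ) ^ (3 / 2 : ℝ)) with hE_def
  set F := Real.exp (2 * (l * c) + 2) with hF_def
  refine ⟨18 * (2 * (4 / (α * κ))) * F * E + 8 * |A2 (θ / 4)| / θ * 2, by positivity,
    Real.exp (32 * W₀ ^ 2 / (α * κ)), ?_⟩
  intro x hx f hf hM y hxy hyx k hk hky a ha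
  set u := Real.log x with hu_def
  have hx0 : 0 < x := (Real.exp_pos _).trans_le hx
  have hu_ge : 32 * (W₀ : ℝ) ^ 2 / (α * κ) ≤ u := (Real.le_log_iff_exp_le hx0).2 hx
  have hακ1 : α * κ ≤ 1 := by nlinarith
  have hu1 : 32 ≤ u := by
    refine le_trans ?_ hu_ge
    rw [le_div_iff₀ hακ]
    nlinarith
  have hx2 : 2 ≤ x := by
    have h1 := Real.add_one_le_exp u
    rw [hu_def, Real.exp_log hx0] at h1
    linarith
  have hy1 : 1 ≤ y := (Real.one_le_rpow (by linarith) hκ.le).trans hxy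
  have hy0 : 0 < y := by linarith
  have hlogy : κ * u ≤ Real.log y := by
    rw [hu_def, ← Real.log_rpow hx0]
    exact Real.log_le_log (Real.rpow_pos_of_pos hx0 _) hxy
  have hlogyx : Real.log y ≤ u := Real.log_le_log hy0 hyx
  set Z := α / 4 * Real.log y with hZ_def
  have hZu : α * κ / 4 * u ≤ Z := by
    rw [hZ_def]
    nlinarith
  have hZW : 8 * (W₀ : ℝ) ^ 2 ≤ Z := by
    refine le_trans ?_ hZu
    rw [div_le_iff₀ hακ] at hu_ge
    linarith
  have hZ0 : 0 < Z := by nlinarith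
  have hZK : 8 * K ≤ Z := by nlinarith
  have hWZ : (W₀ : ℝ) ≤ Real.exp (Z / (8 * W₀)) := by
    have h1 : (W₀ : ℝ) ≤ Z / (8 * W₀) := by
      rw [le_div_iff₀ (by positivity)]
      linarith
    linarith [Real.add_one_le_exp (Z / (8 * W₀))]
  have hexpZ : Real.exp Z < x := by
    rw [← Real.lt_log_iff_exp_lt hx0, ← hu_def, hZ_def]
    nlinarith
  have hexp4Z : Real.exp (4 * Z) * k ≤ y := by
    have h1 : Real.exp (4 * Z) = y ^ α := by
      rw [Real.rpow_def_of_pos hy0, hZ_def]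
      congr 1
      ring
    rw [h1]
    calc y ^ α * k ≤ y ^ α * y ^ (1 - α) := by gcongr
      _ = y := by rw [← Real.rpow_add hy0]; norm_num
  set N := ⌈x⌉₊ with hN_def
  set L := ⌈y⌉₊ with hL_def
  have hyL : y ≤ L := Nat.le_ceil y
  have hL2 : (L : ℝ) ≤ 2 * y := by linarith [Nat.ceil_lt_add_one hy0.le]
  have hphi : (0 : ℝ) < Nat.totient k := by exact_mod_cast Nat.totient_pos.2 hk
  set S := (Finset.Icc 1 ⌊x + y⌋₊).filter
          (fun n : ℕ => x ≤ (n : ℝ) ∧ (n : ℝ) < x + y ∧ n % k = a % k) with hS_def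
  set P := Real.exp (∑ p ∈ (Finset.Icc 1 ⌊x⌋₊).filter
              (fun p : ℕ => p.Prime ∧ ¬ p ∣ k), f p / (p : ℝ)) with hP_def
  have hP1 : 1 ≤ P :=
    Real.one_le_exp (sum_nonneg fun p _ => div_nonneg (hf.1 p) (Nat.cast_nonneg p))
  have hS : ∀ n ∈ S, 0 < n ∧ n ∈ Ico N (N + L) ∧ n ≡ a [MOD k] ∧ Real.exp Z < n ∧
      Real.log n ≤ 2 * u := by
    intro n hn
    obtain ⟨hn1, hxn, hnxy, hna⟩ := mem_filter.1 hn
    have hn0 : 0 < n := (mem_Icc.1 hn1).1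
    have hn0r : (0 : ℝ) < n := by exact_mod_cast hn0
    refine ⟨hn0, mem_Ico.2 ⟨Nat.ceil_le.2 hxn, ?_⟩, hna, hexpZ.trans_le hxn, ?_⟩
    · have : (n : ℝ) < (N + L : ℕ) := by
        push_cast
        linarith [Nat.le_ceil x]
      exact_mod_cast this
    · calc Real.log n ≤ Real.log (x ^ 2) := Real.log_le_log hn0r (by nlinarith)
        _ = 2 * u := by rw [Real.log_pow, Nat.cast_ofNat]
  have hgood := sum_not_sq_dvd_le hf hM hA1 N L (x := x) hk ha hl hAl hc.le hK_def.ge hZK hW₀ hWZ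
    (hexp4Z.trans hyL) hexpZ.le
    {n ∈ S | ¬ ∃ m : ℕ, Real.exp (Z / (8 * W₀)) < m ∧ (m : ℝ) ≤ Real.exp Z ∧ m ^ 2 ∣ n} (by
      intro n hn
      obtain ⟨hnS, hsq⟩ := mem_filter.1 hn
      obtain ⟨-, hnI, hna, hZn, hlogn⟩ := hS n hnS
      refine ⟨hnI, hna, hZn, hlogn.trans ?_, fun m h1 h2 h3 => hsq ⟨m, h1, h2, h3⟩⟩
      calc 2 * u = c * (α * κ / 4 * u) := by rw [hc_def]; field_simp; ring
        _ ≤ c * Z := by gcongr)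
  have hbad := sum_sq_dvd_le hM N L (M := Real.exp (Z / (8 * W₀))) (z := Real.exp Z) (u := u)
    hk ha hθ (by linarith) (by
      refine Real.exp_le_exp.2 ?_
      calc θ * u = α * κ / 4 * u / (8 * W₀) := by rw [hθ_def]; field_simp; ring
        _ ≤ _ := by gcongr) (by
      refine le_trans ?_ (hexp4Z.trans hyL)
      rw [← Real.exp_nat_mul]
      gcongr
      push_cast
      linarith)
    {n ∈ S | ∃ m : ℕ, Real.exp (Z / (8 * W₀)) < m ∧ (m : ℝ) ≤ Real.exp Z ∧ m ^ 2 ∣ n} (by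
      intro n hn
      obtain ⟨hnS, hsq⟩ := mem_filter.1 hn
      obtain ⟨hn0, hnI, hna, -, hlogn⟩ := hS n hnS
      exact ⟨hn0, hnI, hna, hlogn, hsq⟩)
  have hu0 : 0 < u := by linarith
  have hLZ : L / (Nat.totient k * Z) ≤ 2 * (4 / (α * κ)) * (y / (Nat.totient k * u)) := by
    calc L / (Nat.totient k * Z) ≤ 2 * y / (Nat.totient k * (α * κ / 4 * u)) := by gcongr
      _ = _ := by field_simp
  have hLu : L / (Nat.totient k * u) ≤ 2 * (y / (Nat.totient k * u)) := by
    calc L / (Nat.totient k * u) ≤ 2 * y / (Nat.totient k * u) := by gcongr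
      _ = _ := by ring
  rw [← sum_filter_add_sum_filter_not S
    (fun n => ∃ m : ℕ, Real.exp (Z / (8 * W₀)) < m ∧ (m : ℝ) ≤ Real.exp Z ∧ m ^ 2 ∣ n)]
  calc _ ≤ 8 * |A2 (θ / 4)| / θ * (L / (Nat.totient k * u)) * 1 +
        18 * (L / (Nat.totient k * Z)) * F * (E * P) := by
        rw [mul_one]
        exact add_le_add hbad hgood
    _ ≤ 8 * |A2 (θ / 4)| / θ * (2 * (y / (Nat.totient k * u))) * P +
        18 * (2 * (4 / (α * κ)) * (y / (Nat.totient k * u))) * F * (E * P) := by gcongr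
    _ = _ := by ring
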